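/- arXiv:math/0508487 — 2 statements merged into one kernel-verified Lean document; each statement's English description precedes it below -/
import Mathlib

section
/- For every α > 0, β ≥ 0 and x ≥ 0, one has E[e^{−α τ_x^+ − β X_{τ_x^+}} 1_{{τ_x^+ < ∞}}] · (∫_0^∞ α e^{−α t} E[e^{−β X̄_t}] dt) = ∫_0^∞ α e^{−α t} E[e^{−β X̄_t} 1_{{X̄_t > x}}] dt. Equivalently, E[e^{−α τ_x^+ − β X_{τ_x^+}} 1_{{τ_x^+ < ∞}}] = E[e^{−β X̄_{e_α}} 1_{{X̄_{e_α} > x}}] / E[e^{−β X̄_{e_α}}]. -/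
open MeasureTheory ProbabilityTheory Set Filter
open scoped ENNReal NNReal Classical

noncomputable section

namespace AKLevy

variable {Ω : Type*}

/-- Running supremum `X̄_t = sup_{0 ≤ s ≤ t} X_s` of a process. -/
def runSup (X : ℝ → Ω → ℝ) (t : ℝ) (ω : Ω) : ℝ :=
  sSup ((fun s => X s ω) '' Set.Icc 0 t)

/-- Running infimum `X̲_t = inf_{0 ≤ s ≤ t} X_s` of a process. -/
def runInf (X : ℝ → Ω → ℝ) (t : ℝ) (ω : Ω) : ℝ :=
  sInf ((fun s => X s ω) '' Set.Icc 0 t)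

/-- All-time supremum `X̄_∞ = sup_{t ≥ 0} X_t`. -/
def supAll (X : ℝ → Ω → ℝ) (ω : Ω) : ℝ :=
  sSup ((fun s => X s ω) '' Set.Ici 0)

/-- All-time infimum `X̲_∞ = inf_{t ≥ 0} X_t`. -/
def infAll (X : ℝ → Ω → ℝ) (ω : Ω) : ℝ :=
  sInf ((fun s => X s ω) '' Set.Ici 0)

/-- `X` is a real-valued Lévy process with respect to the filtration `ℱ`,
on a filtered probability space satisfying the usual conditions. -/
structure IsLevy [m0 : MeasurableSpace Ω] (P : Measure Ω) (ℱ : Filtration ℝ m0)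
    (X : ℝ → Ω → ℝ) : Prop where
  isProb : IsProbabilityMeasure P
  adapted : ∀ t : ℝ, 0 ≤ t → StronglyMeasurable[ℱ t] (X t)
  zero : ∀ᵐ ω ∂P, X 0 ω = 0
  rightCont : ∀ ω, ∀ t : ℝ, 0 ≤ t → ContinuousWithinAt (fun s => X s ω) (Set.Ici t) t
  leftLim : ∀ ω, ∀ t : ℝ, 0 < t →
    ∃ l : ℝ, Tendsto (fun s => X s ω) (nhdsWithin t (Set.Iio t)) (nhds l)
  indepIncrements : ∀ s t : ℝ, 0 ≤ s → s ≤ t →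
    Indep (MeasurableSpace.comap (fun ω => X t ω - X s ω) inferInstance) (ℱ s) P
  stationary : ∀ s t : ℝ, 0 ≤ s → s ≤ t →
    Measure.map (fun ω => X t ω - X s ω) P = Measure.map (X (t - s)) P
  filtRightCont : ∀ t : ℝ, (ℱ t : MeasurableSpace Ω) = ⨅ s ∈ Set.Ioi t, (ℱ s : MeasurableSpace Ω)
  complete : ∀ N : Set Ω, MeasurableSet N → P N = 0 → MeasurableSet[ℱ 0] N

/-- `τ_x^+ < ∞`: the process passes strictly above level `x` at some nonnegative time. -/
def hitsAbove (X : ℝ → Ω → ℝ) (x : ℝ) (ω : Ω) : Prop := ∃ t, 0 ≤ t ∧ x < X t ω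

/-- First passage time above `x`:  `τ_x^+ = inf {t ≥ 0 : X_t > x}` (junk value if never). -/
def tauAbove (X : ℝ → Ω → ℝ) (x : ℝ) (ω : Ω) : ℝ := sInf {t : ℝ | 0 ≤ t ∧ x < X t ω}

/-- `τ_x^- < ∞`: the process passes strictly below level `x` at some nonnegative time. -/
def hitsBelow (X : ℝ → Ω → ℝ) (x : ℝ) (ω : Ω) : Prop := ∃ t, 0 ≤ t ∧ X t ω < x

/-- First passage time below `x`:  `τ_x^- = inf {t ≥ 0 : X_t < x}` (junk value if never). -/
def tauBelow (X : ℝ → Ω → ℝ) (x : ℝ) (ω : Ω) : ℝ := sInf {t : ℝ | 0 ≤ t ∧ X t ω < x}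

/-- The `[0,∞]`-valued first passage time `σ_x = inf { t ≥ 0 : x + X_t < y }`, with `inf ∅ = ∞`. -/
def hitBelowE (X : ℝ → Ω → ℝ) (y x : ℝ) (ω : Ω) : ℝ≥0∞ :=
  if ∃ t, 0 ≤ t ∧ x + X t ω < y then ENNReal.ofReal (sInf {t : ℝ | 0 ≤ t ∧ x + X t ω < y})
  else ∞

/-- The stopped clock `t ∧ σ_x` (real-valued), where `σ_x = inf{ t ≥ 0 : x + X_t < y}`. -/
def stoppedClock (X : ℝ → Ω → ℝ) (y x : ℝ) (t : ℝ) (ω : Ω) : ℝ :=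
  (min (ENNReal.ofReal t) (hitBelowE X y x ω)).toReal

/-- A `[0,∞]`-valued stopping time of the filtration `ℱ`. -/
def IsStopTime [m0 : MeasurableSpace Ω] (ℱ : Filtration ℝ m0) (τ : Ω → ℝ≥0∞) : Prop :=
  ∀ t : ℝ, 0 ≤ t → MeasurableSet[ℱ t] {ω | τ ω ≤ ENNReal.ofReal t}

/-- Discounted payoff `e^{-rτ} G(x + X_τ)` at a `[0,∞]`-valued time `τ`, set to `0` on `{τ = ∞}`. -/
def stopPayoff (X : ℝ → Ω → ℝ) (r x : ℝ) (G : ℝ → ℝ) (τ : Ω → ℝ≥0∞) (ω : Ω) : ℝ :=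
  if τ ω ≠ ∞ then Real.exp (-(r * (τ ω).toReal)) * G (x + X ((τ ω).toReal) ω) else 0

/-- Discounted American put payoff `e^{-rτ}(K - e^{x + X_τ})^+ 1_{τ < ∞}`. -/
def putPayoff (X : ℝ → Ω → ℝ) (r K x : ℝ) (τ : Ω → ℝ≥0∞) (ω : Ω) : ℝ :=
  stopPayoff X r x (fun z => max (K - Real.exp z) 0) τ ω

/-- Value function `v(x) = sup_τ E[e^{-rτ}(K - e^{x+X_τ})^+ 1_{τ<∞}]`, the supremum
being over all `[0,∞]`-valued stopping times of `ℱ`. -/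
def putValue [m0 : MeasurableSpace Ω] (P : Measure Ω) (ℱ : Filtration ℝ m0)
    (X : ℝ → Ω → ℝ) (r K x : ℝ) : ℝ :=
  ⨆ τ : {τ : Ω → ℝ≥0∞ // IsStopTime ℱ τ}, ∫ ω, putPayoff X r K x τ.1 ω ∂P

/-- `m = E[e^{X̲_{e_r}}]`, where `e_r` is an independent exponential time of rate `r > 0`,
and `e_0 = ∞`. -/
def mInf [m0 : MeasurableSpace Ω] (P : Measure Ω) (X : ℝ → Ω → ℝ) (r : ℝ) : ℝ :=
  if 0 < r then
    ∫ t in Set.Ioi (0 : ℝ), r * Real.exp (-(r * t)) * (∫ ω, Real.exp (runInf X t ω) ∂P)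
  else ∫ ω, Real.exp (infAll X ω) ∂P

/-- `P(X̲_{e_r} = 0)`, where `e_r` is an independent exponential time of rate `r > 0`,
and `e_0 = ∞`. -/
def atomZeroProb [m0 : MeasurableSpace Ω] (P : Measure Ω) (X : ℝ → Ω → ℝ) (r : ℝ) : ℝ :=
  if 0 < r then
    ∫ t in Set.Ioi (0 : ℝ), r * Real.exp (-(r * t)) * (P {ω | runInf X t ω = 0}).toReal
  else (P {ω | infAll X ω = 0}).toReal

/-- The event `{τ_0^- = 0}`: `0` is (pathwise) immediately reached from below, i.e.
`inf{t ≥ 0 : X_t < 0} = 0`. -/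
def regularBelow (X : ℝ → Ω → ℝ) : Set Ω :=
  {ω | ∀ ε > (0 : ℝ), ∃ t, 0 ≤ t ∧ t < ε ∧ X t ω < 0}

/-- `E[e^{-γ X̄_{e_α}}] = ∫_0^∞ α e^{-α t} E[e^{-γ X̄_t}] dt`. -/
def expSupLT [m0 : MeasurableSpace Ω] (P : Measure Ω) (X : ℝ → Ω → ℝ) (α γ : ℝ) : ℝ :=
  ∫ t in Set.Ioi (0 : ℝ), α * Real.exp (-(α * t)) * (∫ ω, Real.exp (-(γ * runSup X t ω)) ∂P)

/-- The function `h_{α,β}(x) = E[e^{-α σ_x + β (x + X_{σ_x})} 1_{σ_x < ∞}]`, where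
`σ_x = inf{t ≥ 0 : x + X_t < 0}`. -/
def hAB [m0 : MeasurableSpace Ω] (P : Measure Ω) (X : ℝ → Ω → ℝ) (α β : ℝ) (z : ℝ) : ℝ :=
  ∫ ω, (if hitsBelow X (-z) ω then
      Real.exp (-(α * tauBelow X (-z) ω) + β * (z + X (tauBelow X (-z) ω) ω)) else 0) ∂P

/-- `v_y(x) = E[e^{-r σ_x} (K - e^{x + X_{σ_x}})^+ 1_{σ_x<∞}]` where
`σ_x = inf{t ≥ 0 : x + X_t < y}`. -/
def vy [m0 : MeasurableSpace Ω] (P : Measure Ω) (X : ℝ → Ω → ℝ) (r K y : ℝ) (z : ℝ) : ℝ :=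
  ∫ ω, putPayoff X r K z (hitBelowE X y z) ω ∂P

/-- The process `f` (indexed by `t ≥ 0`) is a martingale with respect to `ℱ` and `P`. -/
def MartOn [m0 : MeasurableSpace Ω] (P : Measure Ω) (ℱ : Filtration ℝ m0)
    (f : ℝ → Ω → ℝ) : Prop :=
  (∀ t : ℝ, 0 ≤ t → StronglyMeasurable[ℱ t] (f t)) ∧
  (∀ t : ℝ, 0 ≤ t → Integrable (f t) P) ∧
  ∀ s t : ℝ, 0 ≤ s → s ≤ t → P[f t|ℱ s] =ᵐ[P] f s

/-- The process `f` (indexed by `t ≥ 0`) is a supermartingale w.r.t. `ℱ` and `P`. -/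
def SupermartOn [m0 : MeasurableSpace Ω] (P : Measure Ω) (ℱ : Filtration ℝ m0)
    (f : ℝ → Ω → ℝ) : Prop :=
  (∀ t : ℝ, 0 ≤ t → StronglyMeasurable[ℱ t] (f t)) ∧
  (∀ t : ℝ, 0 ≤ t → Integrable (f t) P) ∧
  ∀ s t : ℝ, 0 ≤ s → s ≤ t → P[f t|ℱ s] ≤ᵐ[P] f s

/-- Maximum of a path over the dyadic grid of mesh `u / 2 ^ m` on `[0, u]`. -/
def gridMax (Y : ℝ → ℝ) (m : ℕ) (u : ℝ) : ℝ :=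
  (Finset.range (2 ^ m + 1)).sup' ⟨0, by simp⟩ (fun j => Y (j * (u / 2 ^ m)))

/-- Dyadic approximation from the right. -/
def dyadicUp (n : ℕ) (t : ℝ) : ℝ := ((⌊(2 : ℝ) ^ n * t⌋ : ℝ) + 1) / 2 ^ n

/-- The process after the random time `σ`, started from `0`. -/
def postProcess (X : ℝ → Ω → ℝ) (σ : Ω → ℝ) (u : ℝ) (ω : Ω) : ℝ :=
  X (σ ω + u) ω - X (σ ω) ω

lemma le_dyadicUp (n : ℕ) (t : ℝ) : t ≤ dyadicUp n t := by
  unfold dyadicUp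
  rw [le_div_iff₀ (by positivity)]
  have := (Int.lt_floor_add_one ((2 : ℝ) ^ n * t)).le
  linarith

lemma dyadicUp_le (n : ℕ) (t : ℝ) : dyadicUp n t ≤ t + (1 / 2) ^ n := by
  unfold dyadicUp
  rw [div_le_iff₀ (by positivity)]
  have := Int.floor_le ((2 : ℝ) ^ n * t)
  have h : ((1 : ℝ) / 2) ^ n * 2 ^ n = 1 := by rw [← mul_pow]; norm_num
  nlinarith

lemma measurable_dyadicUp (n : ℕ) : Measurable (dyadicUp n) :=
  (((Measurable.of_discrete (f := fun k : ℤ => (k : ℝ))).comp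
    (Int.measurable_floor.comp (measurable_id.const_mul _))).add_const 1).div_const _

lemma tendsto_dyadicUp_add (t s : ℝ) :
    Tendsto (fun n => dyadicUp n t + s) atTop (nhdsWithin (t + s) (Ici (t + s))) := by
  refine tendsto_nhdsWithin_iff.2 ⟨?_, Eventually.of_forall fun n => ?_⟩
  · refine Tendsto.add_const s ?_
    refine tendsto_of_tendsto_of_tendsto_of_le_of_le tendsto_const_nhds ?_
      (fun n => le_dyadicUp n t) (fun n => dyadicUp_le n t)
    simpa using (tendsto_pow_atTop_nhds_zero_of_lt_one (r := (1 : ℝ) / 2)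
      (by norm_num) (by norm_num)).const_add t
  · simpa using le_dyadicUp n t

lemma tendsto_comp_dyadicUp_add {Y : ℝ → ℝ}
    (hY : ∀ t, ContinuousWithinAt Y (Ici t) t) (t s : ℝ) :
    Tendsto (fun n => Y (dyadicUp n t + s)) atTop (nhds (Y (t + s))) :=
  (hY (t + s)).tendsto.comp (tendsto_dyadicUp_add t s)

lemma measurable_uncurry_of_rightCont [MeasurableSpace Ω] {X : ℝ → Ω → ℝ}
    (hm : ∀ t, Measurable (X t))
    (hrc : ∀ ω t, ContinuousWithinAt (fun s => X s ω) (Ici t) t) :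
    Measurable (Function.uncurry X) := by
  refine measurable_of_tendsto_metrizable
    (f := fun n (p : ℝ × Ω) => X (dyadicUp n p.1) p.2) (fun n => ?_) ?_
  · have h1 : Measurable (fun q : ℤ × Ω => X (((q.1 : ℝ) + 1) / 2 ^ n) q.2) :=
      measurable_from_prod_countable_right fun k => hm (((k : ℝ) + 1) / 2 ^ n)
    have h2 : Measurable (fun p : ℝ × Ω => (⌊(2 : ℝ) ^ n * p.1⌋, p.2)) :=
      (Int.measurable_floor.comp (measurable_fst.const_mul _)).prodMk measurable_snd
    exact h1.comp h2
  · refine tendsto_pi_nhds.2 fun p => ?_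
    simpa [Function.uncurry] using tendsto_comp_dyadicUp_add (hrc p.2) p.1 0

lemma bddAbove_image_Icc {Y : ℝ → ℝ} (hY : ∀ t, ContinuousWithinAt Y (Ici t) t)
    (hl : ∀ t, 0 < t → ∃ l, Tendsto Y (nhdsWithin t (Iio t)) (nhds l)) (a b : ℝ) (ha : 0 ≤ a) :
    BddAbove (Y '' Icc a b) := by
  refine isCompact_Icc.induction_on (p := fun s => BddAbove (Y '' s)) (by simp)
    (fun s t hst ht => ht.mono (image_mono hst))
    (fun s t hs ht => by rw [image_union]; exact hs.union ht) fun t ht => ?_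
  obtain ⟨r, hr⟩ : ∃ r, ∀ᶠ s in nhdsWithin t (Ici t), Y s ≤ r :=
    ⟨Y t + 1, ((hY t).tendsto.eventually_lt_const (by linarith)).mono fun _ h => h.le⟩
  rcases ht.1.eq_or_lt with h0 | h0
  · refine ⟨{s | Y s ≤ r}, ?_, ⟨r, ?_⟩⟩
    · refine nhdsWithin_mono t ?_ hr
      intro s hs; rw [← h0]; exact hs.1
    · rintro _ ⟨s, hs, rfl⟩; exact hs
  · obtain ⟨l, hl⟩ := hl t (ha.trans_lt h0)
    have h1 : ∀ᶠ s in nhdsWithin t (Iio t), Y s ≤ max r (l + 1) :=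
      (hl.eventually_lt_const (show l < l + 1 by linarith)).mono
        fun _ h => h.le.trans (le_max_right _ _)
    have h2 : ∀ᶠ s in nhdsWithin t (Ici t), Y s ≤ max r (l + 1) :=
      hr.mono fun _ h => h.trans (le_max_left _ _)
    refine ⟨{s | Y s ≤ max r (l + 1)}, mem_nhdsWithin_of_mem_nhds ?_, ⟨max r (l + 1), ?_⟩⟩
    · rw [← nhdsLT_sup_nhdsGE]; exact ⟨h1, h2⟩
    · rintro _ ⟨s, hs, rfl⟩; exact hs

lemma tendsto_gridMax {Y : ℝ → ℝ} (hY : ∀ t, 0 ≤ t → ContinuousWithinAt Y (Ici t) t) {u : ℝ}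
    (hu : 0 < u) (hb : BddAbove (Y '' Icc 0 u)) :
    Tendsto (fun m => gridMax Y m u) atTop (nhds (sSup (Y '' Icc 0 u))) := by
  have hle : ∀ m, gridMax Y m u ≤ sSup (Y '' Icc 0 u) := fun m => by
    refine Finset.sup'_le _ _ fun j hj => le_csSup hb ⟨_, ⟨by positivity, ?_⟩, rfl⟩
    rw [Finset.mem_range, Nat.lt_succ_iff] at hj
    have hj' : (j : ℝ) ≤ 2 ^ m := by exact_mod_cast hj
    calc (j : ℝ) * (u / 2 ^ m) ≤ 2 ^ m * (u / 2 ^ m) := by gcongr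
      _ = u := by field_simp
  refine tendsto_order.2 ⟨fun c hc => ?_, fun c hc =>
    Eventually.of_forall fun m => (hle m).trans_lt hc⟩
  obtain ⟨_, ⟨s, hs, rfl⟩, hcs⟩ := exists_lt_of_lt_csSup
    (((nonempty_Icc.2 hu.le)).image Y) hc
  set k : ℕ → ℕ := fun m => ⌈(2 : ℝ) ^ m * (s / u)⌉₊ with hk
  have hk1 : ∀ m, (2 : ℝ) ^ m * (s / u) ≤ k m := fun m => Nat.le_ceil _
  have hk2 : ∀ m, (k m : ℝ) < 2 ^ m * (s / u) + 1 := fun m =>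
    Nat.ceil_lt_add_one (mul_nonneg (by positivity) (div_nonneg hs.1 hu.le))
  have hk3 : ∀ m, k m ≤ 2 ^ m := fun m => by
    refine Nat.ceil_le.2 ?_
    push_cast
    exact mul_le_of_le_one_right (by positivity) ((div_le_one hu).2 hs.2)
  have h1 : ∀ m, s ≤ k m * (u / 2 ^ m) := fun m => by
    calc s = 2 ^ m * (s / u) * (u / 2 ^ m) := by field_simp
      _ ≤ _ := by gcongr; exact hk1 m
  have h2 : ∀ m, k m * (u / 2 ^ m) ≤ s + u * (1 / 2) ^ m := fun m => by
    calc k m * (u / 2 ^ m) ≤ (2 ^ m * (s / u) + 1) * (u / 2 ^ m) := by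
          gcongr; exact (hk2 m).le
      _ = _ := by rw [one_div, inv_pow]; field_simp
  have ht : Tendsto (fun m => (k m : ℝ) * (u / 2 ^ m)) atTop (nhdsWithin s (Ici s)) := by
    refine tendsto_nhdsWithin_iff.2 ⟨?_, Eventually.of_forall h1⟩
    refine tendsto_of_tendsto_of_tendsto_of_le_of_le tendsto_const_nhds ?_ h1 h2
    simpa using ((tendsto_pow_atTop_nhds_zero_of_lt_one (r := (1 : ℝ) / 2)
      (by norm_num) (by norm_num)).const_mul u).const_add s
  filter_upwards [((hY s hs.1).tendsto.comp ht).eventually_const_lt hcs] with m hm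
  exact hm.trans_le (Finset.le_sup' (fun j : ℕ => Y (j * (u / 2 ^ m)))
    (by simpa [Nat.lt_succ_iff] using hk3 m))

lemma measurable_gridMax {S : Type*} [MeasurableSpace S] {Y : ℝ → S → ℝ}
    (hY : Measurable (Function.uncurry Y)) {v : S → ℝ} (hv : Measurable v) (m : ℕ) :
    Measurable (fun p => gridMax (fun s => Y s p) m (v p)) := by
  unfold gridMax
  refine Finset.measurable_range_sup'' fun j _ => ?_
  exact hY.comp (((hv.div_const _).const_mul _).prodMk measurable_id)

lemma tendsto_gridMax_of_pointwise {ι : Type*} {l : Filter ι} {F : ι → ℝ → ℝ} {G : ℝ → ℝ}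
    (h : ∀ t, Tendsto (fun i => F i t) l (nhds (G t))) (m : ℕ) (u : ℝ) :
    Tendsto (fun i => gridMax (F i) m u) l (nhds (gridMax G m u)) := by
  unfold gridMax
  exact Tendsto.finset_sup'_nhds_apply (f := fun (j : ℕ) i => F i (j * (u / 2 ^ m))) _
    fun j _ => h _

/-- The `j`-th increment of `X` after time `s` along the grid of mesh `δ`. -/
def incr (X : ℝ → Ω → ℝ) (s δ : ℝ) (j : ℕ) (ω : Ω) : ℝ :=
  X (s + ((j + 1 : ℕ) : ℝ) * δ) ω - X (s + (j : ℝ) * δ) ω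

lemma measure_inter_incr [m0 : MeasurableSpace Ω] {P : Measure Ω} {ℱ : Filtration ℝ m0}
    {X : ℝ → Ω → ℝ} (hX : IsLevy P ℱ X) {s δ : ℝ} (hs : 0 ≤ s) (hδ : 0 ≤ δ) {A : Set Ω}
    (hA : MeasurableSet[ℱ s] A) {B : ℕ → Set ℝ} (hB : ∀ j, MeasurableSet (B j)) (N : ℕ) :
    MeasurableSet[ℱ (s + N * δ)] (A ∩ {ω | ∀ j < N, incr X s δ j ω ∈ B j}) ∧
      P (A ∩ {ω | ∀ j < N, incr X s δ j ω ∈ B j}) =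
        P A * ∏ j ∈ Finset.range N, P.map (X δ) (B j) := by
  induction N with
  | zero =>
    have h0 : s + ((0 : ℕ) : ℝ) * δ = s := by simp
    rw [h0]
    simpa using hA
  | succ N ih =>
    have hle : s + (N : ℝ) * δ ≤ s + ((N + 1 : ℕ) : ℝ) * δ := by push_cast; nlinarith
    have h0 : 0 ≤ s + (N : ℝ) * δ := by positivity
    have hset : A ∩ {ω | ∀ j < N + 1, incr X s δ j ω ∈ B j} =
        (A ∩ {ω | ∀ j < N, incr X s δ j ω ∈ B j}) ∩ incr X s δ N ⁻¹' B N := by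
      ext ω
      simp only [mem_inter_iff, mem_ofPred_eq, mem_preimage, Nat.lt_succ_iff_lt_or_eq]
      constructor
      · exact fun h => ⟨⟨h.1, fun j hj => h.2 j (Or.inl hj)⟩, h.2 N (Or.inr rfl)⟩
      · rintro ⟨⟨h1, h2⟩, h3⟩
        refine ⟨h1, fun j hj => ?_⟩
        rcases hj with hj | rfl
        exacts [h2 j hj, h3]
    have hinc : Measurable[ℱ (s + ((N + 1 : ℕ) : ℝ) * δ)] (incr X s δ N) :=
      Measurable.sub (hX.adapted _ (h0.trans hle)).measurable
        ((hX.adapted _ h0).measurable.mono (ℱ.mono hle) le_rfl)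
    have hmap : P (incr X s δ N ⁻¹' B N) = P.map (X δ) (B N) := by
      have h := hX.stationary _ _ h0 hle
      have hd : s + ((N + 1 : ℕ) : ℝ) * δ - (s + (N : ℝ) * δ) = δ := by push_cast; ring
      rw [hd] at h
      exact (Measure.map_apply (hinc.mono (ℱ.le _) le_rfl) (hB N)).symm.trans
        (congrArg (fun μ => μ (B N)) h)
    rw [hset]
    refine ⟨(ℱ.mono hle _ ih.1).inter (hinc (hB N)), ?_⟩
    have hind := (Indep_iff _ _ P).1 (hX.indepIncrements _ _ h0 hle) _ _ ⟨B N, hB N, rfl⟩ ih.1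
    rw [inter_comm]
    refine hind.trans ?_
    rw [Finset.prod_range_succ, ih.2, ← hmap]
    exact (mul_comm _ _).trans (mul_assoc _ _ _)

lemma measurable_incr [m0 : MeasurableSpace Ω] {P : Measure Ω} {ℱ : Filtration ℝ m0}
    {X : ℝ → Ω → ℝ} (hX : IsLevy P ℱ X) {s δ : ℝ} (hs : 0 ≤ s) (hδ : 0 ≤ δ) (j : ℕ) :
    Measurable (incr X s δ j) :=
  Measurable.sub ((hX.adapted _ (by positivity)).measurable.mono (ℱ.le _) le_rfl)
    ((hX.adapted _ (by positivity)).measurable.mono (ℱ.le _) le_rfl)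

lemma map_cond_incr [m0 : MeasurableSpace Ω] {P : Measure Ω} {ℱ : Filtration ℝ m0}
    {X : ℝ → Ω → ℝ} (hX : IsLevy P ℱ X) {s δ : ℝ} (hs : 0 ≤ s) (hδ : 0 ≤ δ) {A : Set Ω}
    (hA : MeasurableSet[ℱ s] A) (hPA : P A ≠ 0) (N : ℕ) :
    (P[|A]).map (fun ω (j : Fin N) => incr X s δ j ω) =
      Measure.pi (fun _ : Fin N => P.map (X δ)) := by
  have := hX.isProb
  have := Measure.isProbabilityMeasure_map (μ := P)
    ((hX.adapted δ hδ).measurable.mono (ℱ.le _) le_rfl).aemeasurable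
  symm
  refine Measure.pi_eq fun B hB => ?_
  have hm : Measurable (fun ω (j : Fin N) => incr X s δ j ω) :=
    measurable_pi_lambda _ fun j => measurable_incr hX hs hδ j
  rw [Measure.map_apply hm (MeasurableSet.univ_pi hB), cond_apply (ℱ.le _ _ hA)]
  set B' : ℕ → Set ℝ := fun j => if h : j < N then B ⟨j, h⟩ else univ with hB'
  have hB'm : ∀ j, MeasurableSet (B' j) := fun j => by
    simp only [hB']; split_ifs
    exacts [hB _, MeasurableSet.univ]
  have hset : (fun ω (j : Fin N) => incr X s δ j ω) ⁻¹' (univ.pi B) =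
      {ω | ∀ j < N, incr X s δ j ω ∈ B' j} := by
    ext ω
    simp only [mem_preimage, Set.mem_pi, mem_univ, true_imp_iff, mem_ofPred_eq, hB']
    constructor
    · intro h j hj; simpa [hj] using h ⟨j, hj⟩
    · intro h j; simpa using h j j.2
  rw [hset, (measure_inter_incr hX hs hδ hA hB'm N).2, ← mul_assoc,
    ENNReal.inv_mul_cancel hPA (measure_ne_top P A), one_mul, ← Fin.prod_univ_eq_prod_range
      (fun j => P.map (X δ) (B' j))]
  simp [hB']

lemma map_incr [m0 : MeasurableSpace Ω] {P : Measure Ω} {ℱ : Filtration ℝ m0}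
    {X : ℝ → Ω → ℝ} (hX : IsLevy P ℱ X) {s δ : ℝ} (hs : 0 ≤ s) (hδ : 0 ≤ δ) (N : ℕ) :
    P.map (fun ω (j : Fin N) => incr X s δ j ω) =
      Measure.pi (fun _ : Fin N => P.map (X δ)) := by
  have := hX.isProb
  simpa using map_cond_incr hX hs hδ (A := univ) MeasurableSet.univ (by simp) N

lemma indep_incr [m0 : MeasurableSpace Ω] {P : Measure Ω} {ℱ : Filtration ℝ m0}
    {X : ℝ → Ω → ℝ} (hX : IsLevy P ℱ X) {s δ : ℝ} (hs : 0 ≤ s) (hδ : 0 ≤ δ) (N : ℕ) :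
    Indep (ℱ s) (MeasurableSpace.comap (fun ω (j : Fin N) => incr X s δ j ω) inferInstance)
      P := by
  have := hX.isProb
  have hm : Measurable (fun ω (j : Fin N) => incr X s δ j ω) :=
    measurable_pi_lambda _ fun j => measurable_incr hX hs hδ j
  rw [Indep_iff]
  rintro A _ hA ⟨C, hC, rfl⟩
  by_cases hPA : P A = 0
  · rw [hPA, zero_mul]
    exact measure_mono_null inter_subset_left hPA
  · have h := map_cond_incr hX hs hδ hA hPA N
    rw [← map_incr hX hs hδ N] at h
    have h' := congrArg (fun μ => μ C) h
    simp only [Measure.map_apply hm hC, cond_apply (ℱ.le _ _ hA)] at h'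
    rw [← h', ← mul_assoc, ENNReal.mul_inv_cancel hPA (measure_ne_top P A), one_mul]

/-- The maximum of the partial sums of a finite vector. -/
def partialSumMax (N : ℕ) (v : Fin N → ℝ) : ℝ :=
  (Finset.range (N + 1)).sup' ⟨0, by simp⟩ (fun k => ∑ j : Fin N, if (j : ℕ) < k then v j else 0)

lemma measurable_partialSumMax (N : ℕ) : Measurable (partialSumMax N) := by
  unfold partialSumMax
  refine Finset.measurable_range_sup'' fun k _ => ?_
  refine Finset.measurable_sum _ fun j _ => ?_
  split_ifs
  · exact measurable_pi_apply j
  · exact measurable_const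

lemma gridMax_postProcess_const (X : ℝ → Ω → ℝ) (s u : ℝ) (m : ℕ) (ω : Ω) :
    gridMax (fun v => postProcess X (fun _ => s) v ω) m u =
      partialSumMax (2 ^ m) (fun j => incr X s (u / 2 ^ m) j ω) := by
  unfold gridMax partialSumMax
  refine Finset.sup'_congr _ rfl fun k hk => ?_
  rw [Finset.mem_range, Nat.lt_succ_iff] at hk
  rw [Fin.sum_univ_eq_sum_range (fun j => if j < k then incr X s (u / 2 ^ m) j ω else 0),
    ← Finset.sum_filter]
  have : (Finset.range (2 ^ m)).filter (fun j => j < k) = Finset.range k := by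
    ext j; simp only [Finset.mem_filter, Finset.mem_range]; omega
  rw [this]
  unfold incr postProcess
  rw [Finset.sum_range_sub (fun j : ℕ => X (s + (j : ℝ) * (u / 2 ^ m)) ω)]
  simp

lemma lintegral_mul_gridMax_postProcess [m0 : MeasurableSpace Ω] {P : Measure Ω}
    {ℱ : Filtration ℝ m0} {X : ℝ → Ω → ℝ} (hX : IsLevy P ℱ X) {s u : ℝ} (hs : 0 ≤ s)
    (hu : 0 ≤ u) (m : ℕ) {Z : Ω → ℝ≥0∞} (hZ : Measurable[ℱ s] Z) {ψ : ℝ → ℝ≥0∞}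
    (hψ : Measurable ψ) :
    ∫⁻ ω, Z ω * ψ (gridMax (fun v => postProcess X (fun _ => s) v ω) m u) ∂P =
      (∫⁻ ω, Z ω ∂P) *
        ∫⁻ ω, ψ (gridMax (fun v => postProcess X (fun _ => 0) v ω) m u) ∂P := by
  have hδ : 0 ≤ u / 2 ^ m := by positivity
  have hm : ∀ r : ℝ, 0 ≤ r →
      Measurable (fun ω (j : Fin (2 ^ m)) => incr X r (u / 2 ^ m) j ω) := fun r hr =>
    measurable_pi_lambda _ fun j => measurable_incr hX hr hδ j
  have hf : Measurable (fun v => ψ (partialSumMax (2 ^ m) v)) :=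
    hψ.comp (measurable_partialSumMax _)
  simp only [gridMax_postProcess_const]
  refine (lintegral_mul_eq_lintegral_mul_lintegral_of_independent_measurableSpace (ℱ.le s)
    (hm s hs).comap_le (indep_incr hX hs hδ (2 ^ m)) hZ (hf.comp (comap_measurable _))).trans ?_
  congr 1
  refine (lintegral_map hf (hm s hs)).symm.trans ?_
  rw [map_incr hX hs hδ, ← map_incr hX le_rfl hδ, lintegral_map hf (hm 0 le_rfl)]

lemma tauAbove_nonneg (X : ℝ → Ω → ℝ) (x : ℝ) (ω : Ω) : 0 ≤ tauAbove X x ω :=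
  Real.sInf_nonneg fun _ h => h.1

lemma bddBelow_passage (X : ℝ → Ω → ℝ) (x : ℝ) (ω : Ω) :
    BddBelow {t : ℝ | 0 ≤ t ∧ x < X t ω} := ⟨0, fun _ h => h.1⟩

lemma exists_lt_of_tauAbove_lt {X : ℝ → Ω → ℝ} {x : ℝ} {ω : Ω} (h : hitsAbove X x ω) {r : ℝ}
    (hr : tauAbove X x ω < r) : ∃ t, 0 ≤ t ∧ t < r ∧ x < X t ω := by
  obtain ⟨t, ht, htr⟩ := exists_lt_of_csInf_lt (s := {t : ℝ | 0 ≤ t ∧ x < X t ω}) h hr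
  exact ⟨t, ht.1, htr, ht.2⟩

lemma tauAbove_le {X : ℝ → Ω → ℝ} {x : ℝ} {ω : Ω} {t : ℝ} (ht : 0 ≤ t) (h : x < X t ω) :
    tauAbove X x ω ≤ t :=
  csInf_le (bddBelow_passage X x ω) ⟨ht, h⟩

lemma le_apply_tauAbove {X : ℝ → Ω → ℝ} {x : ℝ} {ω : Ω} (h : hitsAbove X x ω)
    (hrc : ∀ t, ContinuousWithinAt (fun s => X s ω) (Ici t) t) : x ≤ X (tauAbove X x ω) ω := by
  by_contra! hlt
  have h1 := (hrc (tauAbove X x ω)).tendsto.eventually_lt_const hlt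
  obtain ⟨r, hr, hr'⟩ := mem_nhdsGE_iff_exists_Ico_subset.1 h1
  obtain ⟨t, ht0, htr, hxt⟩ := exists_lt_of_tauAbove_lt h hr
  have : X t ω < x := hr' ⟨tauAbove_le ht0 hxt, htr⟩
  exact lt_asymm this hxt

lemma measurableSet_tauAbove_lt [m0 : MeasurableSpace Ω] {P : Measure Ω} {ℱ : Filtration ℝ m0}
    {X : ℝ → Ω → ℝ} (hX : IsLevy P ℱ X)
    (hrc : ∀ ω t, ContinuousWithinAt (fun s => X s ω) (Ici t) t) (x r : ℝ) :
    MeasurableSet[ℱ r] {ω | hitsAbove X x ω ∧ tauAbove X x ω < r} := by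
  have hset : {ω | hitsAbove X x ω ∧ tauAbove X x ω < r} =
      ⋃ q : {q : ℚ // 0 ≤ (q : ℝ) ∧ (q : ℝ) < r}, {ω | x < X (q.1 : ℝ) ω} := by
    ext ω
    simp only [mem_iUnion, mem_ofPred_eq]
    constructor
    · rintro ⟨h, hr⟩
      obtain ⟨t, ht0, htr, hxt⟩ := exists_lt_of_tauAbove_lt h hr
      obtain ⟨v, hv, hv'⟩ := mem_nhdsGE_iff_exists_Ico_subset.1
        ((hrc ω t).tendsto.eventually_const_lt hxt)
      obtain ⟨q, hq1, hq2⟩ := exists_rat_btwn (lt_min htr hv)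
      exact ⟨⟨q, ht0.trans hq1.le, hq2.trans_le (min_le_left _ _)⟩,
        hv' ⟨hq1.le, hq2.trans_le (min_le_right _ _)⟩⟩
    · rintro ⟨⟨q, hq0, hqr⟩, hq⟩
      exact ⟨⟨q, hq0, hq⟩, (tauAbove_le hq0 hq).trans_lt hqr⟩
  rw [hset]
  refine MeasurableSet.iUnion fun q => ?_
  exact ((hX.adapted _ q.2.1).measurable.mono (ℱ.mono q.2.2.le) le_rfl) measurableSet_Ioi

lemma measurableSet_hitsAbove [m0 : MeasurableSpace Ω] {P : Measure Ω} {ℱ : Filtration ℝ m0}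
    {X : ℝ → Ω → ℝ} (hX : IsLevy P ℱ X)
    (hrc : ∀ ω t, ContinuousWithinAt (fun s => X s ω) (Ici t) t) (x : ℝ) :
    MeasurableSet {ω | hitsAbove X x ω} := by
  have hset : {ω | hitsAbove X x ω} =
      ⋃ n : ℕ, {ω | hitsAbove X x ω ∧ tauAbove X x ω < n} := by
    ext ω
    simp only [mem_iUnion, mem_ofPred_eq, exists_and_left]
    exact ⟨fun h => ⟨h, exists_nat_gt _⟩, fun h => h.1⟩
  rw [hset]
  exact MeasurableSet.iUnion fun n => ℱ.le _ _ (measurableSet_tauAbove_lt hX hrc x n)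

lemma measurable_tauAbove [m0 : MeasurableSpace Ω] {P : Measure Ω} {ℱ : Filtration ℝ m0}
    {X : ℝ → Ω → ℝ} (hX : IsLevy P ℱ X)
    (hrc : ∀ ω t, ContinuousWithinAt (fun s => X s ω) (Ici t) t) (x : ℝ) :
    Measurable (tauAbove X x) := by
  refine measurable_of_Iio fun r => ?_
  have hset : tauAbove X x ⁻¹' Iio r = {ω | hitsAbove X x ω ∧ tauAbove X x ω < r} ∪
      ({ω | hitsAbove X x ω}ᶜ ∩ {_ω | 0 < r}) := by
    ext ω
    simp only [mem_preimage, mem_Iio, mem_union, mem_ofPred_eq, mem_inter_iff, mem_compl_iff]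
    by_cases h : hitsAbove X x ω
    · simp [h]
    · have : {t : ℝ | 0 ≤ t ∧ x < X t ω} = ∅ := eq_empty_iff_forall_notMem.2 fun t ht => h ⟨t, ht⟩
      simp [h, tauAbove, this]
  rw [hset]
  exact (ℱ.le _ _ (measurableSet_tauAbove_lt hX hrc x r)).union
    ((measurableSet_hitsAbove hX hrc x).compl.inter (MeasurableSet.const _))

lemma measurableSet_floor_tauAbove [m0 : MeasurableSpace Ω] {P : Measure Ω}
    {ℱ : Filtration ℝ m0} {X : ℝ → Ω → ℝ} (hX : IsLevy P ℱ X)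
    (hrc : ∀ ω t, ContinuousWithinAt (fun s => X s ω) (Ici t) t) (x : ℝ) (n : ℕ) (k : ℤ) :
    MeasurableSet[ℱ (((k : ℝ) + 1) / 2 ^ n)]
      {ω | hitsAbove X x ω ∧ ⌊(2 : ℝ) ^ n * tauAbove X x ω⌋ = k} := by
  have hset : {ω | hitsAbove X x ω ∧ ⌊(2 : ℝ) ^ n * tauAbove X x ω⌋ = k} =
      {ω | hitsAbove X x ω ∧ tauAbove X x ω < ((k : ℝ) + 1) / 2 ^ n} \
        {ω | hitsAbove X x ω ∧ tauAbove X x ω < (k : ℝ) / 2 ^ n} := by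
    ext ω
    have hp : (0 : ℝ) < 2 ^ n := by positivity
    simp only [mem_ofPred_eq, Set.mem_sdiff, Int.floor_eq_iff, lt_div_iff₀ hp,
      mul_comm (tauAbove X x ω), not_and, not_lt]
    tauto
  rw [hset]
  refine (measurableSet_tauAbove_lt hX hrc x _).diff
    (ℱ.mono ?_ _ (measurableSet_tauAbove_lt hX hrc x _))
  gcongr
  linarith

lemma setLIntegral_mul_gridMax_dyadicUp [m0 : MeasurableSpace Ω] {P : Measure Ω}
    {ℱ : Filtration ℝ m0} {X : ℝ → Ω → ℝ} (hX : IsLevy P ℱ X)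
    (hrc : ∀ ω t, ContinuousWithinAt (fun s => X s ω) (Ici t) t) (x : ℝ) (n m : ℕ) {u : ℝ}
    (hu : 0 ≤ u) {w : ℝ → ℝ → ℝ≥0∞} (hw : ∀ t, Measurable (w t)) {ψ : ℝ → ℝ≥0∞}
    (hψ : Measurable ψ) :
    ∫⁻ ω in {ω | hitsAbove X x ω},
        w (dyadicUp n (tauAbove X x ω)) (X (dyadicUp n (tauAbove X x ω)) ω) *
        ψ (gridMax (fun v => postProcess X (fun ω => dyadicUp n (tauAbove X x ω)) v ω) m u) ∂P =
      (∫⁻ ω in {ω | hitsAbove X x ω},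
        w (dyadicUp n (tauAbove X x ω)) (X (dyadicUp n (tauAbove X x ω)) ω) ∂P) *
        ∫⁻ ω, ψ (gridMax (fun v => postProcess X (fun _ => 0) v ω) m u) ∂P := by
  set S : ℤ → Set Ω := fun k => {ω | hitsAbove X x ω ∧ ⌊(2 : ℝ) ^ n * tauAbove X x ω⌋ = k}
    with hS
  have hSm : ∀ k : ℤ, MeasurableSet[ℱ (((k : ℝ) + 1) / 2 ^ n)] (S k) :=
    measurableSet_floor_tauAbove hX hrc x n
  have hSm' : ∀ k, MeasurableSet (S k) := fun k => ℱ.le _ _ (hSm k)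
  have hK : {ω | hitsAbove X x ω} = ⋃ k, S k := by
    ext ω; simp [hS]
  have hdisj : Pairwise (Function.onFun Disjoint S) := fun i j hij =>
    disjoint_left.2 fun ω hi hj => hij (hi.2.symm.trans hj.2)
  rw [hK, lintegral_iUnion hSm' hdisj, lintegral_iUnion hSm' hdisj, ← ENNReal.tsum_mul_right]
  refine tsum_congr fun k => ?_
  by_cases hk : k < 0
  · have : S k = ∅ := by
      refine eq_empty_iff_forall_notMem.2 fun ω hω => ?_
      have h0 : (0 : ℤ) ≤ ⌊(2 : ℝ) ^ n * tauAbove X x ω⌋ :=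
        Int.floor_nonneg.2 (mul_nonneg (by positivity) (tauAbove_nonneg X x ω))
      have := hω.2
      omega
    simp [this]
  push Not at hk
  set r : ℝ := ((k : ℝ) + 1) / 2 ^ n with hr
  have hk' : (0 : ℝ) ≤ k := by exact_mod_cast hk
  have hr0 : 0 ≤ r := by positivity
  have hd : ∀ ω ∈ S k, dyadicUp n (tauAbove X x ω) = r := fun ω hω => by
    unfold dyadicUp; rw [hω.2]
  have hZ : Measurable[ℱ r] ((S k).indicator fun ω => w r (X r ω)) :=
    ((hw r).comp (hX.adapted r hr0).measurable).indicator (hSm k)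
  have h := lintegral_mul_gridMax_postProcess hX hr0 hu m hZ hψ
  rw [lintegral_indicator (hSm' k)] at h
  have e2 : ∫⁻ ω in S k, w (dyadicUp n (tauAbove X x ω)) (X (dyadicUp n (tauAbove X x ω)) ω) ∂P =
      ∫⁻ ω in S k, w r (X r ω) ∂P :=
    setLIntegral_congr_fun (hSm' k) fun ω hω => by simp only [hd ω hω]
  rw [e2, ← h, ← lintegral_indicator (hSm' k)]
  refine lintegral_congr fun ω => ?_
  by_cases hω : ω ∈ S k
  · simp only [indicator_of_mem hω, postProcess, hd ω hω]
  · simp only [indicator_of_notMem hω, zero_mul]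

/-- Discounted weight `e^{-α t - β y⁺}`. -/
def weight (α β t y : ℝ) : ℝ≥0∞ := ENNReal.ofReal (Real.exp (-(α * t) - β * max y 0))

/-- The function `e^{-β r}`, with values in `[0, ∞]`. -/
def expNeg (β r : ℝ) : ℝ≥0∞ := ENNReal.ofReal (Real.exp (-(β * r)))

lemma continuous_weight (α β : ℝ) : Continuous (Function.uncurry (weight α β)) := by
  unfold weight Function.uncurry
  exact ENNReal.continuous_ofReal.comp (by fun_prop)

lemma continuous_expNeg (β : ℝ) : Continuous (expNeg β) := by
  unfold expNeg
  exact ENNReal.continuous_ofReal.comp (by fun_prop)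

lemma weight_le_one {α β t : ℝ} (hα : 0 ≤ α) (hβ : 0 ≤ β) (ht : 0 ≤ t) (y : ℝ) :
    weight α β t y ≤ 1 := by
  refine ENNReal.ofReal_le_one.2 (Real.exp_le_one_iff.2 ?_)
  have h1 := mul_nonneg hα ht
  have h2 := mul_nonneg hβ (le_max_right y 0)
  linarith

lemma expNeg_le_one {β r : ℝ} (hβ : 0 ≤ β) (hr : 0 ≤ r) : expNeg β r ≤ 1 :=
  ENNReal.ofReal_le_one.2 (Real.exp_le_one_iff.2 (by have := mul_nonneg hβ hr; linarith))

lemma gridMax_postProcess_nonneg (X : ℝ → Ω → ℝ) (σ : Ω → ℝ) (m : ℕ) (u : ℝ) (ω : Ω) :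
    0 ≤ gridMax (fun v => postProcess X σ v ω) m u := by
  refine le_trans (le_of_eq ?_) (Finset.le_sup' _ (show 0 ∈ Finset.range (2 ^ m + 1) by simp))
  simp [postProcess]

lemma measurable_postProcess [MeasurableSpace Ω] {X : ℝ → Ω → ℝ}
    (hm : Measurable (Function.uncurry X)) {σ : Ω → ℝ} (hσ : Measurable σ) :
    Measurable (Function.uncurry (postProcess X σ)) := by
  unfold postProcess Function.uncurry
  exact (hm.comp (((hσ.comp measurable_snd).add measurable_fst).prodMk measurable_snd)).sub
    (hm.comp ((hσ.comp measurable_snd).prodMk measurable_snd))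

lemma setLIntegral_weight_mul_gridMax [m0 : MeasurableSpace Ω] {P : Measure Ω}
    {ℱ : Filtration ℝ m0} {X : ℝ → Ω → ℝ} (hX : IsLevy P ℱ X)
    (hm : Measurable (Function.uncurry X))
    (hrc : ∀ ω t, ContinuousWithinAt (fun s => X s ω) (Ici t) t) {α β : ℝ} (hα : 0 ≤ α)
    (hβ : 0 ≤ β) (x : ℝ) (m : ℕ) {u : ℝ} (hu : 0 ≤ u) :
    ∫⁻ ω in {ω | hitsAbove X x ω}, weight α β (tauAbove X x ω) (X (tauAbove X x ω) ω) *
        expNeg β (gridMax (fun v => postProcess X (tauAbove X x) v ω) m u) ∂P =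
      (∫⁻ ω in {ω | hitsAbove X x ω}, weight α β (tauAbove X x ω) (X (tauAbove X x ω) ω) ∂P) *
        ∫⁻ ω, expNeg β (gridMax (fun v => postProcess X (fun _ => 0) v ω) m u) ∂P := by
  have := hX.isProb
  have hτ := measurable_tauAbove hX hrc x
  have hτ0 := tauAbove_nonneg X x
  have hσ : ∀ n, Measurable fun ω => dyadicUp n (tauAbove X x ω) := fun n =>
    (measurable_dyadicUp n).comp hτ
  have hσ0 : ∀ n ω, 0 ≤ dyadicUp n (tauAbove X x ω) := fun n ω =>
    (hτ0 ω).trans (le_dyadicUp n _)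
  have hwm : ∀ n, Measurable fun ω =>
      weight α β (dyadicUp n (tauAbove X x ω)) (X (dyadicUp n (tauAbove X x ω)) ω) := fun n =>
    (continuous_weight α β).measurable.comp ((hσ n).prodMk
      (hm.comp ((hσ n).prodMk measurable_id)))
  have hem : ∀ n, Measurable fun ω => expNeg β
      (gridMax (fun v => postProcess X (fun ω => dyadicUp n (tauAbove X x ω)) v ω) m u) :=
    fun n => (continuous_expNeg β).measurable.comp
      (measurable_gridMax (measurable_postProcess hm (hσ n)) measurable_const m)
  have hwlim : ∀ ω, Tendsto (fun n =>
      weight α β (dyadicUp n (tauAbove X x ω)) (X (dyadicUp n (tauAbove X x ω)) ω)) atTop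
      (nhds (weight α β (tauAbove X x ω) (X (tauAbove X x ω) ω))) := fun ω => by
    have h1 := (tendsto_dyadicUp_add (tauAbove X x ω) 0).mono_right nhdsWithin_le_nhds
    have h2 := tendsto_comp_dyadicUp_add (hrc ω) (tauAbove X x ω) 0
    simp only [add_zero] at h1 h2
    have h3 := ((continuous_weight α β).tendsto (tauAbove X x ω, X (tauAbove X x ω) ω)).comp
      (h1.prodMk_nhds h2)
    exact h3
  have helim : ∀ ω, Tendsto (fun n => expNeg β
      (gridMax (fun v => postProcess X (fun ω => dyadicUp n (tauAbove X x ω)) v ω) m u)) atTop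
      (nhds (expNeg β (gridMax (fun v => postProcess X (tauAbove X x) v ω) m u))) := fun ω => by
    refine ((continuous_expNeg β).tendsto _).comp (tendsto_gridMax_of_pointwise (fun v => ?_) m u)
    have h2 := tendsto_comp_dyadicUp_add (hrc ω) (tauAbove X x ω) 0
    simp only [add_zero] at h2
    exact (tendsto_comp_dyadicUp_add (hrc ω) (tauAbove X x ω) v).sub h2
  have hw1 : ∀ n ω, weight α β (dyadicUp n (tauAbove X x ω))
      (X (dyadicUp n (tauAbove X x ω)) ω) ≤ 1 := fun n ω => weight_le_one hα hβ (hσ0 n ω) _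
  have he1 : ∀ n ω, expNeg β (gridMax (fun v =>
      postProcess X (fun ω => dyadicUp n (tauAbove X x ω)) v ω) m u) ≤ 1 := fun n ω =>
    expNeg_le_one hβ (gridMax_postProcess_nonneg _ _ _ _ _)
  have hL := tendsto_lintegral_of_dominated_convergence
    (μ := P.restrict {ω | hitsAbove X x ω}) (fun _ => (1 : ℝ≥0∞))
    (fun n => (hwm n).mul (hem n))
    (fun n => Eventually.of_forall fun ω => mul_le_one' (hw1 n ω) (he1 n ω)) (by simp)
    (Eventually.of_forall fun ω => ENNReal.Tendsto.mul (hwlim ω) (Or.inr (by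
      simp [expNeg])) (helim ω) (Or.inr (by simp [weight])))
  have hR := tendsto_lintegral_of_dominated_convergence
    (μ := P.restrict {ω | hitsAbove X x ω}) (fun _ => (1 : ℝ≥0∞)) hwm
    (fun n => Eventually.of_forall (hw1 n)) (by simp) (Eventually.of_forall hwlim)
  have hc : ∫⁻ ω, expNeg β (gridMax (fun v => postProcess X (fun _ => 0) v ω) m u) ∂P ≠ ∞ := by
    refine ne_top_of_le_ne_top ENNReal.one_ne_top ((lintegral_mono fun ω =>
      expNeg_le_one hβ (gridMax_postProcess_nonneg X _ m u ω)).trans (by simp))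
  refine tendsto_nhds_unique hL ?_
  refine (ENNReal.Tendsto.mul_const hR (Or.inr hc)).congr fun n => ?_
  exact (setLIntegral_mul_gridMax_dyadicUp hX hrc x n m hu (w := weight α β) (ψ := expNeg β)
    (fun t => (continuous_weight α β).measurable.comp (measurable_const.prodMk measurable_id))
    (continuous_expNeg β).measurable).symm

lemma postProcess_rightCont {X : ℝ → Ω → ℝ} {ω : Ω}
    (hrc : ∀ t, ContinuousWithinAt (fun s => X s ω) (Ici t) t) (σ : Ω → ℝ) (t : ℝ) :
    ContinuousWithinAt (fun s => postProcess X σ s ω) (Ici t) t := by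
  unfold postProcess
  refine ContinuousWithinAt.sub ?_ continuousWithinAt_const
  exact ContinuousWithinAt.comp (t := Ici (σ ω + t)) (hrc (σ ω + t))
    (by fun_prop) (fun s hs => by simpa using hs)

lemma bddAbove_postProcess {X : ℝ → Ω → ℝ} {ω : Ω}
    (hb : ∀ a b, 0 ≤ a → BddAbove ((fun s => X s ω) '' Icc a b)) {σ : Ω → ℝ} (hσ : 0 ≤ σ ω)
    (u : ℝ) : BddAbove ((fun s => postProcess X σ s ω) '' Icc 0 u) := by
  obtain ⟨M, hM⟩ := hb (σ ω) (σ ω + u) hσ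
  refine ⟨M - X (σ ω) ω, ?_⟩
  rintro _ ⟨s, hs, rfl⟩
  have := hM ⟨σ ω + s, ⟨by linarith [hs.1], by linarith [hs.2]⟩, rfl⟩
  simp only [postProcess] at this ⊢
  linarith

lemma tendsto_gridMax_postProcess {X : ℝ → Ω → ℝ} {ω : Ω}
    (hrc : ∀ t, ContinuousWithinAt (fun s => X s ω) (Ici t) t)
    (hb : ∀ a b, 0 ≤ a → BddAbove ((fun s => X s ω) '' Icc a b)) {σ : Ω → ℝ} (hσ : 0 ≤ σ ω)
    {u : ℝ} (hu : 0 < u) :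
    Tendsto (fun m => gridMax (fun v => postProcess X σ v ω) m u) atTop
      (nhds (runSup (postProcess X σ) u ω)) :=
  tendsto_gridMax (fun t _ => postProcess_rightCont hrc σ t) hu (bddAbove_postProcess hb hσ u)

lemma setLIntegral_weight_mul_runSup [m0 : MeasurableSpace Ω] {P : Measure Ω}
    {ℱ : Filtration ℝ m0} {X : ℝ → Ω → ℝ} (hX : IsLevy P ℱ X)
    (hm : Measurable (Function.uncurry X))
    (hrc : ∀ ω t, ContinuousWithinAt (fun s => X s ω) (Ici t) t)
    (hb : ∀ ω a b, 0 ≤ a → BddAbove ((fun s => X s ω) '' Icc a b)) {α β : ℝ} (hα : 0 ≤ α)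
    (hβ : 0 ≤ β) (x : ℝ) {u : ℝ} (hu : 0 < u) :
    ∫⁻ ω in {ω | hitsAbove X x ω}, weight α β (tauAbove X x ω) (X (tauAbove X x ω) ω) *
        expNeg β (runSup (postProcess X (tauAbove X x)) u ω) ∂P =
      (∫⁻ ω in {ω | hitsAbove X x ω}, weight α β (tauAbove X x ω) (X (tauAbove X x ω) ω) ∂P) *
        ∫⁻ ω, expNeg β (runSup (postProcess X (fun _ => 0)) u ω) ∂P := by
  have := hX.isProb
  have hτ := measurable_tauAbove hX hrc x
  have hτ0 := tauAbove_nonneg X x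
  have hwm : Measurable fun ω => weight α β (tauAbove X x ω) (X (tauAbove X x ω) ω) :=
    (continuous_weight α β).measurable.comp (hτ.prodMk (hm.comp (hτ.prodMk measurable_id)))
  have hw1 : ∀ ω, weight α β (tauAbove X x ω) (X (tauAbove X x ω) ω) ≤ 1 := fun ω =>
    weight_le_one hα hβ (hτ0 ω) _
  have hem : ∀ {σ : Ω → ℝ}, Measurable σ → ∀ m, Measurable fun ω =>
      expNeg β (gridMax (fun v => postProcess X σ v ω) m u) := fun hσ m =>
    (continuous_expNeg β).measurable.comp
      (measurable_gridMax (measurable_postProcess hm hσ) measurable_const m)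
  have he1 : ∀ (σ : Ω → ℝ) m ω, expNeg β (gridMax (fun v => postProcess X σ v ω) m u) ≤ 1 :=
    fun σ m ω => expNeg_le_one hβ (gridMax_postProcess_nonneg _ _ _ _ _)
  have helim : ∀ {σ : Ω → ℝ}, (∀ ω, 0 ≤ σ ω) → ∀ ω, Tendsto (fun m =>
      expNeg β (gridMax (fun v => postProcess X σ v ω) m u)) atTop
      (nhds (expNeg β (runSup (postProcess X σ) u ω))) := fun hσ ω =>
    ((continuous_expNeg β).tendsto _).comp
      (tendsto_gridMax_postProcess (hrc ω) (hb ω) (hσ ω) hu)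
  have hL := tendsto_lintegral_of_dominated_convergence
    (μ := P.restrict {ω | hitsAbove X x ω}) (fun _ => (1 : ℝ≥0∞))
    (fun m => hwm.mul (hem hτ m))
    (fun m => Eventually.of_forall fun ω => mul_le_one' (hw1 ω) (he1 _ m ω)) (by simp)
    (Eventually.of_forall fun ω => ENNReal.Tendsto.const_mul (helim hτ0 ω)
      (Or.inr (by simp [weight])))
  have hR := tendsto_lintegral_of_dominated_convergence (μ := P) (fun _ => (1 : ℝ≥0∞))
    (hem (measurable_const (a := (0 : ℝ)))) (fun m => Eventually.of_forall (he1 _ m)) (by simp)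
    (Eventually.of_forall (helim fun _ => le_rfl))
  have hc : ∫⁻ ω in {ω | hitsAbove X x ω},
      weight α β (tauAbove X x ω) (X (tauAbove X x ω) ω) ∂P ≠ ∞ :=
    ne_top_of_le_ne_top ENNReal.one_ne_top ((lintegral_mono hw1).trans (by simp [prob_le_one]))
  refine tendsto_nhds_unique hL ?_
  refine (ENNReal.Tendsto.const_mul hR (Or.inr hc)).congr fun m => ?_
  exact (setLIntegral_weight_mul_gridMax hX hm hrc hα hβ x m hu.le).symm

lemma runSup_add_tauAbove {X : ℝ → Ω → ℝ} {ω : Ω} {x : ℝ} (h : hitsAbove X x ω)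
    (hrc : ∀ t, ContinuousWithinAt (fun s => X s ω) (Ici t) t)
    (hb : ∀ a b, 0 ≤ a → BddAbove ((fun s => X s ω) '' Icc a b)) {u : ℝ} (hu : 0 ≤ u) :
    runSup X (tauAbove X x ω + u) ω =
      X (tauAbove X x ω) ω + runSup (postProcess X (tauAbove X x)) u ω := by
  have hτ0 := tauAbove_nonneg X x ω
  have hbp := bddAbove_postProcess hb hτ0 u
  refine le_antisymm (csSup_le ((nonempty_Icc.2 (by linarith)).image _) ?_) ?_
  · rintro _ ⟨s, hs, rfl⟩
    rcases lt_or_ge s (tauAbove X x ω) with hlt | hge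
    · have h1 : X s ω ≤ x := by
        by_contra! hxs
        exact (tauAbove_le hs.1 hxs).not_gt hlt
      have h2 : 0 ≤ runSup (postProcess X (tauAbove X x)) u ω :=
        le_csSup hbp ⟨0, ⟨le_rfl, hu⟩, by simp [postProcess]⟩
      have h3 := le_apply_tauAbove h hrc
      simp only
      linarith
    · have h2 : postProcess X (tauAbove X x) (s - tauAbove X x ω) ω ≤
          runSup (postProcess X (tauAbove X x)) u ω :=
        le_csSup hbp ⟨s - tauAbove X x ω, ⟨by linarith, by linarith [hs.2]⟩, rfl⟩
      simp only [postProcess, add_sub_cancel] at h2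
      simp only
      linarith
  · have h2 : runSup (postProcess X (tauAbove X x)) u ω ≤
        runSup X (tauAbove X x ω + u) ω - X (tauAbove X x ω) ω := by
      refine csSup_le ((nonempty_Icc.2 hu).image _) ?_
      rintro _ ⟨s, hs, rfl⟩
      have h3 : X (tauAbove X x ω + s) ω ≤ runSup X (tauAbove X x ω + u) ω :=
        le_csSup (hb 0 _ le_rfl) ⟨tauAbove X x ω + s,
          ⟨by linarith [hs.1], by linarith [hs.2]⟩, rfl⟩
      simp only [postProcess]
      linarith
    linarith

lemma lt_runSup_of_tauAbove_lt {X : ℝ → Ω → ℝ} {ω : Ω} {x t : ℝ} (h : hitsAbove X x ω)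
    (hb : ∀ a b, 0 ≤ a → BddAbove ((fun s => X s ω) '' Icc a b)) (ht : tauAbove X x ω < t) :
    x < runSup X t ω := by
  obtain ⟨s, hs0, hst, hxs⟩ := exists_lt_of_tauAbove_lt h ht
  exact hxs.trans_le (le_csSup (hb 0 t le_rfl) ⟨s, ⟨hs0, hst.le⟩, rfl⟩)

lemma exists_lt_of_lt_runSup {X : ℝ → Ω → ℝ} {ω : Ω} {x t : ℝ} (ht : 0 ≤ t)
    (hx : x < runSup X t ω) : ∃ s ∈ Icc 0 t, x < X s ω := by
  obtain ⟨_, ⟨s, hs, rfl⟩, hxs⟩ := exists_lt_of_lt_csSup ((nonempty_Icc.2 ht).image _) hx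
  exact ⟨s, hs, hxs⟩

lemma lintegral_exceedance_eq {X : ℝ → Ω → ℝ} {ω : Ω} {x : ℝ} (hx : 0 ≤ x)
    (hrc : ∀ t, ContinuousWithinAt (fun s => X s ω) (Ici t) t)
    (hb : ∀ a b, 0 ≤ a → BddAbove ((fun s => X s ω) '' Icc a b)) {α β : ℝ} (hα : 0 ≤ α) :
    ∫⁻ t in Ioi (0 : ℝ), ENNReal.ofReal (α * Real.exp (-(α * t))) *
        (if x < runSup X t ω then expNeg β (runSup X t ω) else 0) =
      {ω | hitsAbove X x ω}.indicator (fun ω =>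
        weight α β (tauAbove X x ω) (X (tauAbove X x ω) ω) *
        ∫⁻ u in Ioi (0 : ℝ), ENNReal.ofReal (α * Real.exp (-(α * u))) *
          expNeg β (runSup (postProcess X (tauAbove X x)) u ω)) ω := by
  by_cases h : hitsAbove X x ω
  · rw [indicator_of_mem (show ω ∈ {ω | hitsAbove X x ω} from h)]
    have hτ0 := tauAbove_nonneg X x ω
    have hXτ := le_apply_tauAbove h hrc
    set τ := tauAbove X x ω with hτ
    rw [← lintegral_indicator measurableSet_Ioi, ← lintegral_indicator measurableSet_Ioi,
      ← lintegral_add_right_eq_self _ τ, ← lintegral_const_mul' _ _ (by simp [weight])]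
    refine lintegral_congr_ae ?_
    have hne : ∀ᵐ u : ℝ, u ≠ 0 := by simp [ae_iff]
    filter_upwards [hne] with u hu0
    rcases lt_or_gt_of_ne hu0 with hu | hu
    · rw [indicator_of_notMem (show u ∉ Ioi (0 : ℝ) from not_lt.2 hu.le), mul_zero]
      by_cases hut : 0 < u + τ
      · rw [indicator_of_mem (show u + τ ∈ Ioi (0 : ℝ) from hut), if_neg, mul_zero]
        intro hlt
        obtain ⟨s, hs, hxs⟩ := exists_lt_of_lt_runSup hut.le hlt
        have := tauAbove_le hs.1 hxs
        linarith [hs.2]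
      · exact indicator_of_notMem (show u + τ ∉ Ioi (0 : ℝ) from hut) _
    · have hut : 0 < u + τ := by linarith
      rw [indicator_of_mem (show u + τ ∈ Ioi (0 : ℝ) from hut),
        indicator_of_mem (show u ∈ Ioi (0 : ℝ) from hu),
        if_pos (lt_runSup_of_tauAbove_lt h hb (by linarith)), add_comm u τ,
        runSup_add_tauAbove h hrc hb hu.le, ← hτ]
      unfold expNeg weight
      rw [← ENNReal.ofReal_mul (by positivity), ← ENNReal.ofReal_mul (by positivity),
        ← ENNReal.ofReal_mul (by positivity), max_eq_left (hx.trans hXτ)]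
      congr 1
      have he : Real.exp (-(α * (τ + u))) *
          Real.exp (-(β * (X τ ω + runSup (postProcess X (tauAbove X x)) u ω))) =
          Real.exp (-(α * τ) - β * X τ ω) * (Real.exp (-(α * u)) *
            Real.exp (-(β * runSup (postProcess X (tauAbove X x)) u ω))) := by
        rw [← Real.exp_add, ← Real.exp_add, ← Real.exp_add]
        congr 1
        ring
      linear_combination α * he
  · rw [indicator_of_notMem (show ω ∉ {ω | hitsAbove X x ω} from h)]
    refine (setLIntegral_congr_fun measurableSet_Ioi fun t ht => ?_).trans
      (lintegral_zero (μ := volume.restrict (Ioi (0 : ℝ))))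
    rw [if_neg, mul_zero]
    intro hlt
    obtain ⟨s, hs, hxs⟩ := exists_lt_of_lt_runSup (le_of_lt ht) hlt
    exact h ⟨s, hs.1, hxs⟩

lemma measurable_uncurry_runSup [MeasurableSpace Ω] {Y : ℝ → Ω → ℝ}
    (hm : Measurable (Function.uncurry Y))
    (hrc : ∀ ω t, ContinuousWithinAt (fun s => Y s ω) (Ici t) t)
    (hb : ∀ ω u, BddAbove ((fun s => Y s ω) '' Icc 0 u)) :
    Measurable (Function.uncurry (runSup Y)) := by
  refine measurable_of_tendsto_metrizable (f := fun m (p : ℝ × Ω) =>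
    if 0 < p.1 then gridMax (fun s => Y s p.2) m p.1 else if p.1 = 0 then Y 0 p.2 else 0)
    (fun m => ?_) (tendsto_pi_nhds.2 fun p => ?_)
  · have h1 : Measurable fun p : ℝ × Ω => gridMax (fun s => Y s p.2) m p.1 :=
      measurable_gridMax (Y := fun s (p : ℝ × Ω) => Y s p.2)
        (hm.comp (measurable_fst.prodMk (measurable_snd.comp measurable_snd))) measurable_fst m
    have h2 : Measurable fun p : ℝ × Ω => Y 0 p.2 :=
      hm.comp (measurable_const.prodMk measurable_snd)
    exact h1.ite (measurableSet_lt measurable_const measurable_fst)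
      (h2.ite (measurableSet_eq_fun measurable_fst measurable_const) measurable_const)
  · obtain ⟨t, ω⟩ := p
    rcases lt_trichotomy t 0 with h | rfl | h
    · simp [h.not_gt, h.ne, Function.uncurry, runSup, Icc_eq_empty h.not_ge]
    · simp [Function.uncurry, runSup]
    · simpa [h, Function.uncurry, runSup] using
        tendsto_gridMax (fun t _ => hrc ω t) h (hb ω t)

lemma integral_exp_mul_integral_eq [MeasurableSpace Ω] (P : Measure Ω) [IsProbabilityMeasure P]
    {α : ℝ} (hα : 0 ≤ α) {f : ℝ → Ω → ℝ} (hf : Measurable (Function.uncurry f))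
    (h0 : ∀ t ω, 0 ≤ f t ω) (h1 : ∀ t, 0 < t → ∀ᵐ ω ∂P, f t ω ≤ 1) :
    ∫ t in Ioi (0 : ℝ), α * Real.exp (-(α * t)) * (∫ ω, f t ω ∂P) =
      (∫⁻ t in Ioi (0 : ℝ), ENNReal.ofReal (α * Real.exp (-(α * t))) *
        ∫⁻ ω, ENNReal.ofReal (f t ω) ∂P).toReal := by
  rw [integral_eq_lintegral_of_nonneg_ae]
  · congr 1
    refine setLIntegral_congr_fun measurableSet_Ioi fun t ht => ?_
    have hft : Measurable (f t) := hf.comp (measurable_const.prodMk measurable_id)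
    have hfin : ∫⁻ ω, ENNReal.ofReal (f t ω) ∂P ≠ ∞ := by
      refine ne_top_of_le_ne_top ENNReal.one_ne_top ((lintegral_mono_ae (g := fun _ => 1)
        ((h1 t ht).mono fun ω h => ENNReal.ofReal_le_one.2 h)).trans (by simp))
    rw [ENNReal.ofReal_mul (by positivity), integral_eq_lintegral_of_nonneg_ae
      (Eventually.of_forall (h0 t)) hft.aestronglyMeasurable, ENNReal.ofReal_toReal hfin]
  · exact Eventually.of_forall fun t => mul_nonneg (by positivity) (integral_nonneg (h0 t))
  · have h2 : StronglyMeasurable fun t => ∫ ω, f t ω ∂P :=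
      hf.stronglyMeasurable.integral_prod_right
    have h3 : Measurable fun t : ℝ => α * Real.exp (-(α * t)) := by fun_prop
    exact (h3.mul h2.measurable).aestronglyMeasurable

lemma lintegral_exceedance [m0 : MeasurableSpace Ω] {P : Measure Ω}
    {ℱ : Filtration ℝ m0} {X : ℝ → Ω → ℝ} (hX : IsLevy P ℱ X)
    (hm : Measurable (Function.uncurry X))
    (hrc : ∀ ω t, ContinuousWithinAt (fun s => X s ω) (Ici t) t)
    (hb : ∀ ω a b, 0 ≤ a → BddAbove ((fun s => X s ω) '' Icc a b)) {α β x : ℝ} (hα : 0 ≤ α)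
    (hβ : 0 ≤ β) (hx : 0 ≤ x) :
    (∫⁻ ω in {ω | hitsAbove X x ω}, weight α β (tauAbove X x ω) (X (tauAbove X x ω) ω) ∂P) *
        (∫⁻ t in Ioi (0 : ℝ), ENNReal.ofReal (α * Real.exp (-(α * t))) *
          ∫⁻ ω, expNeg β (runSup X t ω) ∂P) =
      ∫⁻ t in Ioi (0 : ℝ), ENNReal.ofReal (α * Real.exp (-(α * t))) *
        ∫⁻ ω, (if x < runSup X t ω then expNeg β (runSup X t ω) else 0) ∂P := by
  have := hX.isProb
  have hτ := measurable_tauAbove hX hrc x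
  have hτ0 := tauAbove_nonneg X x
  have hK := measurableSet_hitsAbove hX hrc x
  have hM := measurable_uncurry_runSup hm hrc (fun ω u => hb ω 0 u le_rfl)
  have hM' := measurable_uncurry_runSup (measurable_postProcess hm hτ)
    (fun ω => postProcess_rightCont (hrc ω) (tauAbove X x))
    (fun ω u => bddAbove_postProcess (hb ω) (hτ0 ω) u)
  have hE := (continuous_expNeg β).measurable
  have ha : Measurable fun t : ℝ => ENNReal.ofReal (α * Real.exp (-(α * t))) := by fun_prop
  have hw : Measurable fun ω => weight α β (tauAbove X x ω) (X (tauAbove X x ω) ω) :=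
    (continuous_weight α β).measurable.comp (hτ.prodMk (hm.comp (hτ.prodMk measurable_id)))
  have hg : Measurable fun p : ℝ × Ω =>
      if x < runSup X p.1 p.2 then expNeg β (runSup X p.1 p.2) else 0 :=
    (hE.comp hM).ite (measurableSet_lt measurable_const hM) measurable_const
  have hswap1 : AEMeasurable (Function.uncurry fun (t : ℝ) (ω : Ω) =>
      ENNReal.ofReal (α * Real.exp (-(α * t))) *
        (if x < runSup X t ω then expNeg β (runSup X t ω) else 0))
      ((volume.restrict (Ioi (0 : ℝ))).prod P) :=
    ((ha.comp measurable_fst).mul hg).aemeasurable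
  have hswap2 : AEMeasurable (Function.uncurry fun (ω : Ω) (u : ℝ) =>
      weight α β (tauAbove X x ω) (X (tauAbove X x ω) ω) *
        (ENNReal.ofReal (α * Real.exp (-(α * u))) *
          expNeg β (runSup (postProcess X (tauAbove X x)) u ω)))
      ((P.restrict {ω | hitsAbove X x ω}).prod (volume.restrict (Ioi (0 : ℝ)))) :=
    ((hw.comp measurable_fst).mul ((ha.comp measurable_snd).mul
      ((hE.comp hM').comp measurable_swap))).aemeasurable
  symm
  calc
    _ = ∫⁻ t in Ioi (0 : ℝ), ∫⁻ ω, ENNReal.ofReal (α * Real.exp (-(α * t))) *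
          (if x < runSup X t ω then expNeg β (runSup X t ω) else 0) ∂P :=
      lintegral_congr fun t => (lintegral_const_mul' _ _ ENNReal.ofReal_ne_top).symm
    _ = ∫⁻ ω, (∫⁻ t in Ioi (0 : ℝ), ENNReal.ofReal (α * Real.exp (-(α * t))) *
          (if x < runSup X t ω then expNeg β (runSup X t ω) else 0)) ∂P :=
      lintegral_lintegral_swap hswap1
    _ = ∫⁻ ω in {ω | hitsAbove X x ω}, weight α β (tauAbove X x ω) (X (tauAbove X x ω) ω) *
          (∫⁻ u in Ioi (0 : ℝ), ENNReal.ofReal (α * Real.exp (-(α * u))) *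
            expNeg β (runSup (postProcess X (tauAbove X x)) u ω)) ∂P := by
      rw [← lintegral_indicator hK]
      exact lintegral_congr fun ω => lintegral_exceedance_eq hx (hrc ω) (hb ω) hα
    _ = ∫⁻ ω in {ω | hitsAbove X x ω}, (∫⁻ u in Ioi (0 : ℝ),
          weight α β (tauAbove X x ω) (X (tauAbove X x ω) ω) *
            (ENNReal.ofReal (α * Real.exp (-(α * u))) *
              expNeg β (runSup (postProcess X (tauAbove X x)) u ω))) ∂P :=
      lintegral_congr fun ω => (lintegral_const_mul' _ _ (by simp [weight])).symm
    _ = ∫⁻ u in Ioi (0 : ℝ), ∫⁻ ω in {ω | hitsAbove X x ω},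
          weight α β (tauAbove X x ω) (X (tauAbove X x ω) ω) *
            (ENNReal.ofReal (α * Real.exp (-(α * u))) *
              expNeg β (runSup (postProcess X (tauAbove X x)) u ω)) ∂P :=
      lintegral_lintegral_swap hswap2
    _ = ∫⁻ u in Ioi (0 : ℝ),
          (∫⁻ ω in {ω | hitsAbove X x ω},
            weight α β (tauAbove X x ω) (X (tauAbove X x ω) ω) ∂P) *
          (ENNReal.ofReal (α * Real.exp (-(α * u))) * ∫⁻ ω, expNeg β (runSup X u ω) ∂P) := by
      refine setLIntegral_congr_fun measurableSet_Ioi fun u hu => ?_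
      have h0 : ∫⁻ ω, expNeg β (runSup X u ω) ∂P =
          ∫⁻ ω, expNeg β (runSup (postProcess X (fun _ => 0)) u ω) ∂P := by
        refine lintegral_congr_ae ?_
        filter_upwards [hX.zero] with ω hω
        simp only [runSup, postProcess, zero_add, hω, sub_zero]
      simp only [mul_left_comm _ (ENNReal.ofReal (α * Real.exp (-(α * u))))]
      rw [lintegral_const_mul' _ _ ENNReal.ofReal_ne_top,
        setLIntegral_weight_mul_runSup hX hm hrc hb hα hβ x hu, h0]
    _ = _ := by
      refine lintegral_const_mul _ (ha.mul ?_)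
      exact (hE.comp hM).lintegral_prod_right'

lemma fluctuation_identity_of_measurable [m0 : MeasurableSpace Ω] {P : Measure Ω}
    {ℱ : Filtration ℝ m0} {X : ℝ → Ω → ℝ} (hX : IsLevy P ℱ X)
    (hm : Measurable (Function.uncurry X))
    (hrc : ∀ ω t, ContinuousWithinAt (fun s => X s ω) (Ici t) t)
    {α β x : ℝ} (hα : 0 ≤ α) (hβ : 0 ≤ β) (hx : 0 ≤ x) :
    (∫ ω, (if hitsAbove X x ω then
        Real.exp (-(α * tauAbove X x ω) - β * X (tauAbove X x ω) ω) else 0) ∂P) *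
      (∫ t in Set.Ioi (0 : ℝ), α * Real.exp (-(α * t)) *
        (∫ ω, Real.exp (-(β * runSup X t ω)) ∂P)) =
      ∫ t in Set.Ioi (0 : ℝ), α * Real.exp (-(α * t)) *
        (∫ ω, (if x < runSup X t ω then Real.exp (-(β * runSup X t ω)) else 0) ∂P) := by
  have := hX.isProb
  have hb : ∀ ω a b, 0 ≤ a → BddAbove ((fun s => X s ω) '' Icc a b) := fun ω a b ha =>
    bddAbove_image_Icc (hrc ω) (hX.leftLim ω) a b ha
  have hτ := measurable_tauAbove hX hrc x
  have hK := measurableSet_hitsAbove hX hrc x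
  have hM := measurable_uncurry_runSup hm hrc (fun ω u => hb ω 0 u le_rfl)
  have hE : Measurable fun r : ℝ => Real.exp (-(β * r)) := by fun_prop
  have hXτ : Measurable fun ω => X (tauAbove X x ω) ω := hm.comp (hτ.prodMk measurable_id)
  have hfirst : ∫ ω, (if hitsAbove X x ω then
        Real.exp (-(α * tauAbove X x ω) - β * X (tauAbove X x ω) ω) else 0) ∂P =
      (∫⁻ ω in {ω | hitsAbove X x ω},
        weight α β (tauAbove X x ω) (X (tauAbove X x ω) ω) ∂P).toReal := by
    rw [integral_eq_lintegral_of_nonneg_ae, ← lintegral_indicator hK]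
    · congr 1
      refine lintegral_congr fun ω => ?_
      by_cases h : hitsAbove X x ω
      · rw [if_pos h, indicator_of_mem (show ω ∈ {ω | hitsAbove X x ω} from h), weight,
          max_eq_left (hx.trans (le_apply_tauAbove h (hrc ω)))]
      · rw [if_neg h, indicator_of_notMem (show ω ∉ {ω | hitsAbove X x ω} from h),
          ENNReal.ofReal_zero]
    · refine Eventually.of_forall fun ω => ?_
      simp only [Pi.zero_apply]
      split_ifs
      exacts [(Real.exp_pos _).le, le_rfl]
    · have h1 : Measurable fun ω =>
          Real.exp (-(α * tauAbove X x ω) - β * X (tauAbove X x ω) ω) := by fun_prop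
      exact (h1.ite hK measurable_const).aestronglyMeasurable
  have hsecond := integral_exp_mul_integral_eq P hα
    (f := fun t ω => Real.exp (-(β * runSup X t ω))) (hE.comp hM)
    (fun t ω => (Real.exp_pos _).le) (fun t ht => by
      filter_upwards [hX.zero] with ω hω
      have h0 : 0 ≤ runSup X t ω := hω ▸ le_csSup (hb ω 0 t le_rfl) ⟨0, ⟨le_rfl, ht.le⟩, rfl⟩
      exact Real.exp_le_one_iff.2 (by have := mul_nonneg hβ h0; linarith))
  have hthird := integral_exp_mul_integral_eq P hα
    (f := fun t ω => if x < runSup X t ω then Real.exp (-(β * runSup X t ω)) else 0)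
    ((hE.comp hM).ite (measurableSet_lt measurable_const hM) measurable_const)
    (fun t ω => by split_ifs; exacts [(Real.exp_pos _).le, le_rfl]) (fun t _ => by
      refine Eventually.of_forall fun ω => ?_
      split_ifs with h
      · exact Real.exp_le_one_iff.2 (by have := mul_nonneg hβ (hx.trans h.le); linarith)
      · exact zero_le_one)
  rw [hfirst, hsecond, hthird, ← ENNReal.toReal_mul]
  congr 1
  refine (lintegral_exceedance hX hm hrc hb hα hβ hx).trans ?_
  simp only [expNeg, apply_ite ENNReal.ofReal, ENNReal.ofReal_zero]

lemma IsLevy.comp_max_zero [m0 : MeasurableSpace Ω] {P : Measure Ω} {ℱ : Filtration ℝ m0}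
    {X : ℝ → Ω → ℝ} (hX : IsLevy P ℱ X) : IsLevy P ℱ (fun t => X (max t 0)) where
  isProb := hX.isProb
  adapted t ht := by simpa [max_eq_left ht] using hX.adapted t ht
  zero := by simpa using hX.zero
  rightCont ω t ht := (hX.rightCont ω t ht).congr
    (fun s hs => by rw [max_eq_left (ht.trans hs)]) (by rw [max_eq_left ht])
  leftLim ω t ht := by
    obtain ⟨l, hl⟩ := hX.leftLim ω t ht
    refine ⟨l, hl.congr' ?_⟩
    filter_upwards [mem_nhdsWithin_of_mem_nhds (lt_mem_nhds ht)] with s hs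
    rw [max_eq_left (le_of_lt hs)]
  indepIncrements s t hs hst := by
    simpa [max_eq_left hs, max_eq_left (hs.trans hst)] using hX.indepIncrements s t hs hst
  stationary s t hs hst := by
    rw [max_eq_left hs, max_eq_left (hs.trans hst), max_eq_left (sub_nonneg.2 hst)]
    exact hX.stationary s t hs hst
  filtRightCont := hX.filtRightCont
  complete := hX.complete

theorem stmt0 [m0 : MeasurableSpace Ω] (P : Measure Ω) (ℱ : Filtration ℝ m0)
    (X : ℝ → Ω → ℝ) (hX : IsLevy P ℱ X)
    (α β x : ℝ) (hα : 0 < α) (hβ : 0 ≤ β) (hx : 0 ≤ x) :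
    (∫ ω, (if hitsAbove X x ω then
        Real.exp (-(α * tauAbove X x ω) - β * X (tauAbove X x ω) ω) else 0) ∂P) *
      (∫ t in Set.Ioi (0 : ℝ), α * Real.exp (-(α * t)) *
        (∫ ω, Real.exp (-(β * runSup X t ω)) ∂P)) =
      ∫ t in Set.Ioi (0 : ℝ), α * Real.exp (-(α * t)) *
        (∫ ω, (if x < runSup X t ω then Real.exp (-(β * runSup X t ω)) else 0) ∂P) := by
  set Y : ℝ → Ω → ℝ := fun t => X (max t 0) with hYdef
  have hY : IsLevy P ℱ Y := hX.comp_max_zero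
  have hYX : ∀ t, 0 ≤ t → Y t = X t := fun t ht => by simp [hYdef, max_eq_left ht]
  have hrc : ∀ ω t, ContinuousWithinAt (fun s => Y s ω) (Ici t) t := fun ω t =>
    (hX.rightCont ω (max t 0) (le_max_right _ _)).comp (f := fun s => max s 0)
      (by fun_prop) (fun s hs => show max t 0 ≤ max s 0 from max_le_max hs le_rfl)
  have hm : Measurable (Function.uncurry Y) := measurable_uncurry_of_rightCont
    (fun t => (hX.adapted _ (le_max_right t 0)).measurable.mono (ℱ.le _) le_rfl) hrc
  have hsup : runSup X = runSup Y := by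
    ext t ω
    unfold runSup
    congr 1
    exact image_congr fun s hs => by rw [hYX s hs.1]
  have hset : ∀ ω, {t : ℝ | 0 ≤ t ∧ x < X t ω} = {t : ℝ | 0 ≤ t ∧ x < Y t ω} := fun ω => by
    ext t
    exact and_congr_right fun ht => by rw [hYX t ht]
  have htau : tauAbove X x = tauAbove Y x := by
    ext ω
    unfold tauAbove
    rw [hset]
  have hhits : hitsAbove X x = hitsAbove Y x := by
    ext ω
    exact exists_congr fun t => and_congr_right fun ht => by rw [hYX t ht]
  have hval : ∀ ω, X (tauAbove Y x ω) ω = Y (tauAbove Y x ω) ω := fun ω => by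
    rw [hYX _ (tauAbove_nonneg Y x ω)]
  have h := fluctuation_identity_of_measurable hY hm hrc hα.le hβ hx
  simp only [hsup, htau, hhits, hval]
  exact h

end AKLevy
end
end

section
/- For every α > 0, β ≥ 0 and x ≥ 0, one has E[e^{−α τ_{−x}^− + β X_{τ_{−x}^−}} 1_{{τ_{−x}^− < ∞}}] · (∫_0^∞ α e^{−α t} E[e^{β X̲_t}] dt) = ∫_0^∞ α e^{−α t} E[e^{β X̲_t} 1_{{−X̲_t > x}}] dt. Equivalently, E[e^{−α τ_{−x}^− + β X_{τ_{−x}^−}} 1_{{τ_{−x}^− < ∞}}] = E[e^{β X̲_{e_α}} 1_{{−X̲_{e_α} > x}}] / E[e^{β X̲_{e_α}}]. -/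
open MeasureTheory ProbabilityTheory Set Filter
open scoped ENNReal NNReal Classical

noncomputable section

namespace AKLevy

variable {Ω : Type*}

/-- Infimum of a path over the closed interval `[a, b]`. -/
def infOn (f : ℝ → ℝ) (a b : ℝ) : ℝ := sInf (f '' Set.Icc a b)

/-- Real paths on `[0, ∞)` which are right-continuous with left limits. -/
structure IsCadlag (f : ℝ → ℝ) : Prop where
  rightCont : ∀ t : ℝ, 0 ≤ t → ContinuousWithinAt f (Set.Ici t) t
  leftLim : ∀ t : ℝ, 0 < t → ∃ l : ℝ, Tendsto f (nhdsWithin t (Set.Iio t)) (nhds l)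

lemma IsCadlag.exists_right {f : ℝ → ℝ} (hf : IsCadlag f) {a : ℝ} (ha : 0 ≤ a) {ε : ℝ}
    (hε : 0 < ε) : ∃ δ > 0, ∀ r, a ≤ r → r < a + δ → |f r - f a| < ε := by
  obtain ⟨δ, hδ, h⟩ := Metric.continuousWithinAt_iff.1 (hf.rightCont a ha) ε hε
  refine ⟨δ, hδ, fun r h1 h2 => ?_⟩
  have := h (x := r) h1 (by rw [Real.dist_eq, abs_of_nonneg] <;> linarith)
  rwa [Real.dist_eq] at this

lemma IsCadlag.bddBelow_image {f : ℝ → ℝ} (hf : IsCadlag f) {a : ℝ} (ha : 0 ≤ a) (b : ℝ) :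
    BddBelow (f '' Set.Icc a b) := by
  refine isCompact_Icc.induction_on (p := fun s => BddBelow (f '' s)) (by simp)
    (fun s t hst h => h.mono (image_mono hst))
    (fun s t hs ht => by rw [image_union]; exact hs.union ht) fun t ht => ?_
  have of_eventually : ∀ {F : Filter ℝ} {l : ℝ}, Tendsto f F (nhds l) →
      ∃ c, ∀ᶠ s in F, c ≤ f s := fun {F l} h =>
    ⟨l - 1, (h.eventually (lt_mem_nhds (sub_one_lt l))).mono fun _ => le_of_lt⟩
  suffices ∃ c, ∀ᶠ s in nhdsWithin t (Set.Icc a b), c ≤ f s by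
    obtain ⟨c, hc⟩ := this
    refine ⟨_, hc, c, ?_⟩
    rintro _ ⟨s, hs, rfl⟩
    exact hs
  have ht0 : 0 ≤ t := ha.trans ht.1
  obtain ⟨c, hc⟩ := of_eventually (hf.rightCont t ht0)
  rcases ht0.eq_or_lt with h0 | h0
  · refine ⟨c, hc.filter_mono (nhdsWithin_mono _ fun s hs => ?_)⟩
    rw [← h0]
    exact ha.trans hs.1
  · obtain ⟨l, hl⟩ := hf.leftLim t h0
    obtain ⟨d, hd⟩ := of_eventually hl
    refine ⟨min c d, Eventually.filter_mono nhdsWithin_le_nhds ?_⟩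
    rw [← nhdsLT_sup_nhdsGE, eventually_sup]
    exact ⟨hd.mono fun s => (min_le_right c d).trans, hc.mono fun s => (min_le_left c d).trans⟩

lemma IsCadlag.infOn_le {f : ℝ → ℝ} (hf : IsCadlag f) {a b r : ℝ} (ha : 0 ≤ a)
    (har : a ≤ r) (hrb : r ≤ b) : infOn f a b ≤ f r :=
  csInf_le (hf.bddBelow_image ha b) ⟨r, ⟨har, hrb⟩, rfl⟩

lemma le_infOn {f : ℝ → ℝ} {a b c : ℝ} (hab : a ≤ b) (h : ∀ r, a ≤ r → r ≤ b → c ≤ f r) :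
    c ≤ infOn f a b := by
  refine le_csInf ((nonempty_Icc.2 hab).image f) ?_
  rintro _ ⟨r, hr, rfl⟩
  exact h r hr.1 hr.2

lemma exists_lt_of_infOn_lt {f : ℝ → ℝ} {a b c : ℝ} (hab : a ≤ b) (h : infOn f a b < c) :
    ∃ r, a ≤ r ∧ r ≤ b ∧ f r < c := by
  by_contra! hcon
  exact absurd h (le_infOn hab hcon).not_gt

lemma IsCadlag.infOn_continuity {f : ℝ → ℝ} (hf : IsCadlag f) {a b : ℝ} (ha : 0 ≤ a)
    (hab : a ≤ b) {ε : ℝ} (hε : 0 < ε) : ∃ δ > 0, ∀ a' b', a ≤ a' → a' < a + δ → b ≤ b' →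
      b' < b + δ → a' ≤ b' → |infOn f a' b' - infOn f a b| < ε := by
  obtain ⟨δ₁, h₁, H₁⟩ := hf.exists_right ha (half_pos (half_pos hε))
  obtain ⟨δ₂, h₂, H₂⟩ := hf.exists_right (ha.trans hab) (half_pos hε)
  refine ⟨min δ₁ δ₂, lt_min h₁ h₂, fun a' b' haa' ha'δ hbb' hb'δ hab' => ?_⟩
  have hlow : infOn f a b - ε / 2 ≤ infOn f a' b' := by
    refine le_infOn hab' fun r h1 h2 => ?_
    rcases le_total r b with h | h
    · linarith [hf.infOn_le ha (haa'.trans h1) h]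
    · have := (abs_lt.1 (H₂ r h (by linarith [min_le_right δ₁ δ₂]))).1
      linarith [hf.infOn_le ha hab le_rfl]
  have hup : infOn f a' b' - ε / 2 ≤ infOn f a b := by
    refine le_infOn hab fun r h1 h2 => ?_
    rcases le_total a' r with h | h
    · linarith [hf.infOn_le (ha.trans haa') h (h2.trans hbb')]
    · have hr := (abs_lt.1 (H₁ r h1 (by linarith [min_le_left δ₁ δ₂]))).1
      have ha' := (abs_lt.1 (H₁ a' haa' (by linarith [min_le_left δ₁ δ₂]))).2
      linarith [hf.infOn_le (ha.trans haa') le_rfl hab']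
  rw [abs_lt]
  constructor <;> linarith

lemma IsCadlag.infOn_tendsto {f : ℝ → ℝ} (hf : IsCadlag f) {a b : ℝ} (ha : 0 ≤ a)
    (hab : a ≤ b) {ι : Type*} {F : Filter ι} {u v : ι → ℝ}
    (hu : Tendsto u F (nhdsWithin a (Set.Ici a))) (hv : Tendsto v F (nhdsWithin b (Set.Ici b)))
    (huv : ∀ᶠ i in F, u i ≤ v i) :
    Tendsto (fun i => infOn f (u i) (v i)) F (nhds (infOn f a b)) := by
  rw [Metric.tendsto_nhds]
  intro ε hε
  obtain ⟨δ, hδ, H⟩ := hf.infOn_continuity ha hab hε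
  have key : ∀ {c : ℝ} {w : ι → ℝ}, Tendsto w F (nhdsWithin c (Set.Ici c)) →
      ∀ᶠ i in F, c ≤ w i ∧ w i < c + δ := fun {c w} h => h.eventually <|
    (eventually_mem_nhdsWithin).and
      (nhdsWithin_le_nhds (eventually_lt_nhds (lt_add_of_pos_right c hδ)))
  filter_upwards [key hu, key hv, huv] with i h1 h2 h3
  rw [Real.dist_eq]
  exact H _ _ h1.1 h1.2 h2.1 h2.2 h3

/-- Minimum over `k ≤ n` of the increments `f (s + k * h) - f s`, built up recursively. -/
def gridMin (f : ℝ → ℝ) (h : ℝ) : ℕ → ℝ → ℝ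
  | 0, _ => 0
  | n + 1, s => min 0 (f (s + h) - f s + gridMin f h n (s + h))

lemma gridMin_le (f : ℝ → ℝ) (h : ℝ) (n k : ℕ) (hk : k ≤ n) (s : ℝ) :
    gridMin f h n s ≤ f (s + k * h) - f s := by
  induction n generalizing k s with
  | zero => obtain rfl : k = 0 := by omega
            simp [gridMin]
  | succ n ih =>
    cases k with
    | zero => simp [gridMin]
    | succ k =>
      have := ih k (by omega) (s + h)
      have e : s + h + k * h = s + ((k + 1 : ℕ) : ℝ) * h := by push_cast; ring
      rw [e] at this
      exact (min_le_right _ _).trans (by linarith)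

lemma exists_gridMin_eq (f : ℝ → ℝ) (h : ℝ) (n : ℕ) (s : ℝ) :
    ∃ k ≤ n, gridMin f h n s = f (s + k * h) - f s := by
  induction n generalizing s with
  | zero => exact ⟨0, le_rfl, by simp [gridMin]⟩
  | succ n ih =>
    obtain ⟨k, hk, e⟩ := ih (s + h)
    rcases min_choice 0 (f (s + h) - f s + gridMin f h n (s + h)) with h0 | h0
    · exact ⟨0, by omega, by simpa [gridMin] using h0⟩
    · refine ⟨k + 1, by omega, ?_⟩
      rw [gridMin, h0, e, show s + ((k + 1 : ℕ) : ℝ) * h = s + h + k * h by push_cast; ring]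
      ring

lemma IsCadlag.tendsto_gridMin {f : ℝ → ℝ} (hf : IsCadlag f) {s v : ℝ} (hs : 0 ≤ s)
    (hv : 0 ≤ v) : Tendsto (fun n : ℕ => gridMin f (v / (n + 1)) (n + 1) s) atTop
      (nhds (infOn f s (s + v) - f s)) := by
  have hlow : ∀ n : ℕ, infOn f s (s + v) - f s ≤ gridMin f (v / (n + 1)) (n + 1) s := by
    intro n
    obtain ⟨k, hk, e⟩ := exists_gridMin_eq f (v / (n + 1)) (n + 1) s
    have hn : (0 : ℝ) < n + 1 := by positivity
    have hk' : (k : ℝ) ≤ n + 1 := by exact_mod_cast hk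
    have : (k : ℝ) * (v / (n + 1)) ≤ v := by
      rw [← mul_div_assoc, div_le_iff₀ hn]
      nlinarith
    have h0 : 0 ≤ (k : ℝ) * (v / (n + 1)) := by positivity
    rw [e]
    linarith [hf.infOn_le hs (b := s + v) (r := s + k * (v / (n + 1))) (by linarith) (by linarith)]
  rw [Metric.tendsto_atTop]
  intro ε hε
  obtain ⟨r, hr1, hr2, hr⟩ := exists_lt_of_infOn_lt (f := f) (a := s) (b := s + v)
    (c := infOn f s (s + v) + ε / 2) (by linarith) (by linarith)
  obtain ⟨δ, hδ, H⟩ := hf.exists_right (hs.trans hr1) (half_pos hε)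
  obtain ⟨N, hN⟩ := exists_nat_gt (v / δ)
  refine ⟨N, fun n hn => ?_⟩
  have hn0 : (0 : ℝ) < n + 1 := by positivity
  rw [Real.dist_eq, abs_of_nonneg (by linarith [hlow n])]
  rcases hv.eq_or_lt with rfl | hv0
  · have := gridMin_le f (0 / (n + 1)) (n + 1) 0 (by omega) s
    obtain rfl : r = s := by linarith
    simp at this hr ⊢
    linarith
  set h := v / (n + 1) with hh
  have hpos : 0 < h := by positivity
  have hhδ : h < δ := by
    have : (N : ℝ) ≤ n := by exact_mod_cast hn
    rw [div_lt_iff₀ hδ] at hN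
    rw [hh, div_lt_iff₀ hn0]
    nlinarith
  have hmul : ((n : ℝ) + 1) * h = v := by rw [hh]; field_simp
  set k := ⌈(r - s) / h⌉₊ with hk
  have hk1 : r - s ≤ k * h := by
    rw [← div_le_iff₀ hpos]; exact Nat.le_ceil _
  have hk2 : (k : ℝ) * h < r - s + h := by
    have := Nat.ceil_lt_add_one (a := (r - s) / h) (by apply div_nonneg <;> linarith)
    rw [← hk] at this
    calc (k : ℝ) * h < ((r - s) / h + 1) * h := by gcongr
      _ = r - s + h := by field_simp
  have hkn : k ≤ n + 1 := by
    refine Nat.ceil_le.2 ?_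
    rw [div_le_iff₀ hpos]
    push_cast
    linarith
  have h1 := gridMin_le f h (n + 1) k hkn s
  have h2 := (abs_lt.1 (H (s + k * h) (by linarith) (by linarith))).2
  linarith

/-- The first point of the grid `{1 / (n + 1), 2 / (n + 1), …}` strictly after `t ≥ 0`. -/
def gridTime (n : ℕ) (t : ℝ) : ℝ := ((⌊((n : ℝ) + 1) * t⌋₊ : ℝ) + 1) / (n + 1)

lemma lt_gridTime (n : ℕ) (t : ℝ) : t < gridTime n t := by
  have hn0 : (0 : ℝ) < n + 1 := by positivity
  rw [gridTime, lt_div_iff₀ hn0, mul_comm]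
  exact Nat.lt_floor_add_one _

lemma gridTime_le (n : ℕ) {t : ℝ} (ht : 0 ≤ t) : gridTime n t ≤ t + 1 / (n + 1) := by
  have hn0 : (0 : ℝ) < n + 1 := by positivity
  rw [gridTime, div_le_iff₀ hn0]
  have := Nat.floor_le (a := ((n : ℝ) + 1) * t) (by positivity)
  calc _ ≤ ((n : ℝ) + 1) * t + 1 := by gcongr
    _ = _ := by field_simp

lemma tendsto_gridTime {t : ℝ} (ht : 0 ≤ t) :
    Tendsto (fun n => gridTime n t) atTop (nhdsWithin t (Set.Ici t)) := by
  refine tendsto_nhdsWithin_iff.2 ⟨?_, Eventually.of_forall fun n => (lt_gridTime n t).le⟩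
  refine tendsto_of_tendsto_of_tendsto_of_le_of_le tendsto_const_nhds ?_
    (fun n => (lt_gridTime n t).le) fun n => gridTime_le n ht
  simpa using tendsto_const_nhds.add (tendsto_one_div_add_atTop_nhds_zero_nat (𝕜 := ℝ))

lemma measurable_of_rightCont [MeasurableSpace Ω] {g : ℝ → Ω → ℝ}
    (hm : ∀ t, 0 ≤ t → Measurable (g t))
    (hrc : ∀ ω t, 0 ≤ t → ContinuousWithinAt (fun s => g s ω) (Set.Ici t) t) :
    Measurable fun p : ℝ × Ω => g (max p.1 0) p.2 := by
  refine measurable_of_tendsto_metrizable (f := fun (n : ℕ) (p : ℝ × Ω) =>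
    g (gridTime n (max p.1 0)) p.2) (fun n => ?_) (tendsto_pi_nhds.2 fun p => ?_)
  · have h1 : Measurable fun p : ℕ × Ω => g (((p.1 : ℝ) + 1) / (n + 1)) p.2 :=
      measurable_from_prod_countable_right fun k =>
        hm (((k : ℝ) + 1) / (n + 1)) (by positivity)
    have h2 : Measurable fun p : ℝ × Ω => (⌊((n : ℝ) + 1) * max p.1 0⌋₊, p.2) := by fun_prop
    exact h1.comp h2
  · exact (hrc p.2 _ (le_max_right _ _)).tendsto.comp (tendsto_gridTime (le_max_right _ _))

lemma tauBelow_nonneg (X : ℝ → Ω → ℝ) (y : ℝ) (ω : Ω) : 0 ≤ tauBelow X y ω :=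
  Real.sInf_nonneg fun _ ht => ht.1

lemma le_of_lt_tauBelow {X : ℝ → Ω → ℝ} {y s : ℝ} {ω : Ω} (hs : 0 ≤ s) (h : s < tauBelow X y ω) :
    y ≤ X s ω := by
  by_contra! hlt
  exact h.not_ge (csInf_le ⟨0, fun _ ht => ht.1⟩ ⟨hs, hlt⟩)

lemma exists_lt_of_tauBelow_lt {X : ℝ → Ω → ℝ} {y t : ℝ} {ω : Ω}
    (hit : hitsBelow X y ω)
    (h : tauBelow X y ω < t) : ∃ s, tauBelow X y ω ≤ s ∧ s < t ∧ X s ω < y := by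
  obtain ⟨s, hs, hst⟩ := exists_lt_of_csInf_lt (s := {t : ℝ | 0 ≤ t ∧ X t ω < y}) hit h
  exact ⟨s, csInf_le ⟨0, fun _ ht => ht.1⟩ hs, hst, hs.2⟩

/-- Discounted exponential payoff at the time `σ` on the event that `X` passes below `y`. -/
def passagePayoff (X : ℝ → Ω → ℝ) (α β y : ℝ) (σ : Ω → ℝ) (ω : Ω) : ℝ :=
  if hitsBelow X y ω then Real.exp (-(α * σ ω) + β * min (X (σ ω) ω) 0) else 0

lemma abs_passagePayoff_le_one {X : ℝ → Ω → ℝ} {α β : ℝ} (hα : 0 < α) (hβ : 0 ≤ β)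
    (y : ℝ) {σ : Ω → ℝ} (hσ0 : ∀ ω, 0 ≤ σ ω) (ω : Ω) : |passagePayoff X α β y σ ω| ≤ 1 := by
  unfold passagePayoff
  split_ifs
  · rw [Real.abs_exp, Real.exp_le_one_iff]
    have h1 := mul_nonneg hα.le (hσ0 ω)
    have h2 := mul_nonpos_of_nonneg_of_nonpos hβ (min_le_right (X (σ ω) ω) 0)
    linarith
  · simp

section Levy

variable [m0 : MeasurableSpace Ω] {P : Measure Ω} {ℱ : Filtration ℝ m0} {X : ℝ → Ω → ℝ}

lemma IsLevy.isCadlag (hX : IsLevy P ℱ X) (ω : Ω) : IsCadlag fun s => X s ω :=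
  ⟨hX.rightCont ω, hX.leftLim ω⟩

lemma IsLevy.measurable (hX : IsLevy P ℱ X) {t : ℝ} (ht : 0 ≤ t) : Measurable (X t) :=
  ((hX.adapted t ht).mono (ℱ.le t)).measurable

lemma IsLevy.measurable_gridMin (hX : IsLevy P ℱ X) {h : ℝ} (hh : 0 ≤ h) (n : ℕ) {s : ℝ}
    (hs : 0 ≤ s) : Measurable fun ω => gridMin (fun r => X r ω) h n s := by
  induction n generalizing s with
  | zero => exact measurable_const
  | succ n ih =>
    have h1 := hX.measurable hs
    have h2 := hX.measurable (add_nonneg hs hh)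
    exact measurable_const.min ((h2.sub h1).add (ih (add_nonneg hs hh)))

variable (P X) in
/-- Law of the minimum of the first `n` steps of the random walk with step law that of `X h`. -/
def gridLaw (h : ℝ) : ℕ → Measure ℝ
  | 0 => Measure.dirac 0
  | n + 1 => ((P.map (X h)).prod (gridLaw h n)).map fun p => min 0 (p.1 + p.2)

lemma IsLevy.isProbabilityMeasure_gridLaw (hX : IsLevy P ℱ X) {h : ℝ} (hh : 0 ≤ h) (n : ℕ) :
    IsProbabilityMeasure (gridLaw P X h n) := by
  have := hX.isProb
  induction n with
  | zero => exact inferInstanceAs (IsProbabilityMeasure (Measure.dirac 0))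
  | succ n ih =>
    have := Measure.isProbabilityMeasure_map (μ := P) (hX.measurable hh).aemeasurable
    exact Measure.isProbabilityMeasure_map (by fun_prop)

lemma IsLevy.map_restrict_gridMin (hX : IsLevy P ℱ X) {h : ℝ} (hh : 0 ≤ h) (n : ℕ) {s : ℝ}
    (hs : 0 ≤ s) {A : Set Ω} (hA : MeasurableSet[ℱ s] A) :
    (P.restrict A).map (fun ω => gridMin (fun r => X r ω) h n s) = P A • gridLaw P X h n := by
  have := hX.isProb
  induction n generalizing s A with
  | zero =>
    simp only [gridMin, gridLaw]
    rw [Measure.map_const]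
    simp
  | succ n ih =>
    have hsh : 0 ≤ s + h := add_nonneg hs hh
    have hξ : Measurable fun ω => X (s + h) ω - X s ω :=
      (hX.measurable hsh).sub (hX.measurable hs)
    have hM := hX.measurable_gridMin hh n hsh
    have := hX.isProbabilityMeasure_gridLaw hh n
    have := Measure.isProbabilityMeasure_map (μ := P) (hX.measurable hh).aemeasurable
    have : IsFiniteMeasure (P A • P.map (X h)) := Measure.smul_finite _ (measure_ne_top P A)
    have hT : Measurable fun p : ℝ × ℝ => min 0 (p.1 + p.2) := by fun_prop
    have key : (P A • P.map (X h)).prod (gridLaw P X h n) = (P.restrict A).map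
        (fun ω => (X (s + h) ω - X s ω, gridMin (fun r => X r ω) h n (s + h))) := by
      refine Measure.prod_eq fun B C hB hC => ?_
      have hξB : MeasurableSet[ℱ (s + h)] ((fun ω => X (s + h) ω - X s ω) ⁻¹' B) :=
        ((hX.adapted _ hsh).sub ((hX.adapted s hs).mono (ℱ.mono (by linarith)))).measurable hB
      have hA' := hξB.inter (ℱ.mono (show s ≤ s + h by linarith) _ hA)
      have h1 := congrArg (fun ν => ν C) (ih hsh hA')
      have h2 := (Indep_iff _ _ P).1 (hX.indepIncrements s (s + h) hs (by linarith)) _ A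
        ⟨B, hB, rfl⟩ hA
      have h3 := hX.stationary s (s + h) hs (by linarith)
      rw [add_sub_cancel_left] at h3
      rw [Measure.map_apply hM hC, Measure.restrict_apply (hM hC), h2,
        ← Measure.map_apply hξ hB, h3] at h1
      rw [Measure.map_apply (hξ.prodMk hM) (hB.prod hC),
        Measure.restrict_apply ((hξ.prodMk hM) (hB.prod hC)), mk_preimage_prod]
      simp only [Measure.smul_apply, smul_eq_mul] at h1 ⊢
      rw [mul_comm (P A), ← h1]
      congr 1
      ext ω
      simp only [mem_inter_iff]
      tauto
    calc _ = ((P.restrict A).map (fun ω => (X (s + h) ω - X s ω,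
              gridMin (fun r => X r ω) h n (s + h)))).map fun p => min 0 (p.1 + p.2) := by
            rw [Measure.map_map hT (hξ.prodMk hM)]
            rfl
      _ = _ := by
            rw [← key, Measure.prod_smul_left, Measure.map_smul]
            rfl

lemma IsLevy.integral_mul_gridMin (hX : IsLevy P ℱ X) (β : ℝ) {h : ℝ} (hh : 0 ≤ h) (n : ℕ)
    {s : ℝ} (hs : 0 ≤ s) {Y : Ω → ℝ} (hY : Measurable[ℱ s] Y) :
    ∫ ω, Y ω * Real.exp (β * gridMin (fun r => X r ω) h n s) ∂P =
      (∫ ω, Y ω ∂P) * ∫ ω, Real.exp (β * gridMin (fun r => X r ω) h n 0) ∂P := by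
  have := hX.isProb
  have hYm : Measurable Y := hY.mono (ℱ.le s) le_rfl
  have hlaw : ∀ {r : ℝ}, 0 ≤ r →
      P.map (fun ω => gridMin (fun u => X u ω) h n r) = gridLaw P X h n := fun {r} hr => by
    simpa using hX.map_restrict_gridMin hh n hr (A := Set.univ) MeasurableSet.univ
  have hM := hX.measurable_gridMin hh n hs
  have hind : IndepFun Y (fun ω => gridMin (fun r => X r ω) h n s) P := by
    rw [indepFun_iff_measure_inter_preimage_eq_mul]
    intro B C hB hC
    have := congrArg (fun ν => ν C) (hX.map_restrict_gridMin hh n hs (hY hB))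
    simp only [Measure.smul_apply, smul_eq_mul] at this
    rw [Measure.map_apply hM hC, Measure.restrict_apply (hM hC), ← hlaw hs,
      Measure.map_apply hM hC] at this
    rw [inter_comm, this]
  have hexp : Measurable fun z : ℝ => Real.exp (β * z) := by fun_prop
  have hind' := hind.comp measurable_id hexp
  have e := hind'.integral_fun_mul_eq_mul_integral hYm.aestronglyMeasurable
    (hexp.comp hM).aestronglyMeasurable
  simp only [Function.comp, id] at e
  rw [e]
  congr 1
  rw [← integral_map (f := fun z => Real.exp (β * z)) hM.aemeasurable
      hexp.aestronglyMeasurable, hlaw hs, ← hlaw le_rfl,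
    integral_map (hX.measurable_gridMin hh n le_rfl).aemeasurable hexp.aestronglyMeasurable]

lemma IsLevy.measurable_infOn (hX : IsLevy P ℱ X) {s v : ℝ} (hs : 0 ≤ s) (hv : 0 ≤ v) :
    Measurable fun ω => infOn (fun r => X r ω) s (s + v) := by
  have h := measurable_of_tendsto_metrizable
    (fun n : ℕ => hX.measurable_gridMin (h := v / (n + 1)) (by positivity) (n + 1) hs)
    (tendsto_pi_nhds.2 fun ω => (hX.isCadlag ω).tendsto_gridMin hs hv)
  simpa only [Pi.add_def, sub_add_cancel] using h.add (hX.measurable hs)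

lemma IsLevy.integral_mul_infOn (hX : IsLevy P ℱ X) {β : ℝ} (hβ : 0 ≤ β) {s v : ℝ}
    (hs : 0 ≤ s) (hv : 0 ≤ v) {Y : Ω → ℝ} (hY : Measurable[ℱ s] Y) (hYb : ∀ ω, |Y ω| ≤ 1) :
    ∫ ω, Y ω * Real.exp (β * (infOn (fun r => X r ω) s (s + v) - X s ω)) ∂P =
      (∫ ω, Y ω ∂P) * ∫ ω, Real.exp (β * runInf X v ω) ∂P := by
  have := hX.isProb
  have hYm : Measurable Y := hY.mono (ℱ.le s) le_rfl
  have lim : ∀ {r : ℝ}, 0 ≤ r → ∀ {Z : Ω → ℝ}, Measurable Z → (∀ ω, |Z ω| ≤ 1) →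
      Tendsto (fun n : ℕ =>
        ∫ ω, Z ω * Real.exp (β * gridMin (fun u => X u ω) (v / (n + 1)) (n + 1) r) ∂P) atTop
      (nhds (∫ ω, Z ω * Real.exp (β * (infOn (fun u => X u ω) r (r + v) - X r ω)) ∂P)) := by
    intro r hr Z hZ hZb
    refine tendsto_integral_of_dominated_convergence (fun _ => 1) (fun n => ?_)
      (integrable_const _) (fun n => ae_of_all _ fun ω => ?_) (ae_of_all _ fun ω => ?_)
    · have := hX.measurable_gridMin (h := v / (n + 1)) (by positivity) (n + 1) hr
      exact Measurable.aestronglyMeasurable (by fun_prop)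
    · rw [norm_mul, Real.norm_eq_abs, Real.norm_eq_abs, Real.abs_exp]
      refine mul_le_one₀ (hZb ω) (Real.exp_pos _).le (Real.exp_le_one_iff.2 ?_)
      exact mul_nonpos_of_nonneg_of_nonpos hβ (min_le_left _ _)
    · exact (((hX.isCadlag ω).tendsto_gridMin hr hv).const_mul β).rexp.const_mul _
  have h1 := lim hs hYm hYb
  have h2 := (lim le_rfl (Z := fun _ => 1) measurable_const (by simp)).const_mul (∫ ω, Y ω ∂P)
  simp only [one_mul] at h2
  have h3 : ∀ n : ℕ, ∫ ω, Y ω *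
      Real.exp (β * gridMin (fun u => X u ω) (v / (n + 1)) (n + 1) s) ∂P = _ :=
    fun n => hX.integral_mul_gridMin β (h := v / (n + 1)) (by positivity) (n + 1) hs hY
  rw [tendsto_nhds_unique (h1.congr h3) h2]
  congr 1
  refine integral_congr_ae ?_
  filter_upwards [hX.zero] with ω hω
  simp [infOn, runInf, hω]

lemma IsLevy.apply_tauBelow_le (hX : IsLevy P ℱ X) {y : ℝ} {ω : Ω} (hit : hitsBelow X y ω) :
    X (tauBelow X y ω) ω ≤ y := by
  by_contra! hlt
  obtain ⟨δ, hδ, H⟩ := (hX.isCadlag ω).exists_right (tauBelow_nonneg X y ω) (sub_pos.2 hlt)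
  obtain ⟨s, h1, h2, h3⟩ := exists_lt_of_tauBelow_lt hit (lt_add_of_pos_right _ hδ)
  linarith [(abs_lt.1 (H s h1 h2)).1]

lemma IsLevy.measurableSet_tauBelow_lt (hX : IsLevy P ℱ X) (y c : ℝ) :
    MeasurableSet[ℱ c] {ω | hitsBelow X y ω ∧ tauBelow X y ω < c} := by
  have e : {ω | hitsBelow X y ω ∧ tauBelow X y ω < c} =
      ⋃ q : {q : ℚ // 0 ≤ (q : ℝ) ∧ (q : ℝ) < c}, {ω | X (q : ℚ) ω < y} := by
    ext ω
    simp only [mem_ofPred_eq, mem_iUnion]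
    constructor
    · rintro ⟨hit, h⟩
      obtain ⟨s, h1, h2, h3⟩ := exists_lt_of_tauBelow_lt hit h
      have hs := (tauBelow_nonneg X y ω).trans h1
      obtain ⟨δ, hδ, H⟩ := (hX.isCadlag ω).exists_right hs (sub_pos.2 h3)
      obtain ⟨q, hq1, hq2⟩ := exists_rat_btwn (lt_min h2 (lt_add_of_pos_right s hδ))
      refine ⟨⟨q, by linarith, hq2.trans_le (min_le_left _ _)⟩, ?_⟩
      linarith [(abs_lt.1 (H q hq1.le (hq2.trans_le (min_le_right _ _)))).2]
    · rintro ⟨⟨q, h0, hc⟩, h⟩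
      exact ⟨⟨q, h0, h⟩, lt_of_le_of_lt (csInf_le ⟨0, fun _ ht => ht.1⟩ ⟨h0, h⟩) hc⟩
  rw [e]
  refine MeasurableSet.iUnion fun q => ?_
  exact ((hX.adapted _ q.2.1).mono (ℱ.mono q.2.2.le)).measurable measurableSet_Iio

lemma IsLevy.measurableSet_hitsBelow (hX : IsLevy P ℱ X) (y : ℝ) :
    MeasurableSet {ω | hitsBelow X y ω} := by
  have e : {ω | hitsBelow X y ω} =
      ⋃ n : ℕ, {ω | hitsBelow X y ω ∧ tauBelow X y ω < n} := by
    ext ω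
    simp only [mem_ofPred_eq, mem_iUnion, exists_and_left]
    exact ⟨fun h => ⟨h, exists_nat_gt _⟩, fun h => h.1⟩
  rw [e]
  exact MeasurableSet.iUnion fun n => ℱ.le _ _ (hX.measurableSet_tauBelow_lt y n)

lemma IsLevy.measurable_tauBelow (hX : IsLevy P ℱ X) (y : ℝ) :
    Measurable (tauBelow X y) := by
  refine measurable_of_Iio fun c => ?_
  have e : tauBelow X y ⁻¹' Set.Iio c = {ω | hitsBelow X y ω ∧ tauBelow X y ω < c} ∪
      ({ω | hitsBelow X y ω}ᶜ ∩ {_ω | 0 < c}) := by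
    ext ω
    by_cases h : hitsBelow X y ω
    · simp [h]
    · have : tauBelow X y ω = 0 := by
        have h0 : {t : ℝ | 0 ≤ t ∧ X t ω < y} = ∅ := eq_empty_iff_forall_notMem.2
          fun t ht => h ⟨t, ht⟩
        rw [tauBelow, h0, Real.sInf_empty]
      simp [h, this]
  rw [e]
  exact (ℱ.le _ _ (hX.measurableSet_tauBelow_lt y c)).union
    ((hX.measurableSet_hitsBelow y).compl.inter (MeasurableSet.const _))

lemma IsLevy.measurable_apply_time (hX : IsLevy P ℱ X) {σ : Ω → ℝ} (hσ : Measurable σ)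
    (hσ0 : ∀ ω, 0 ≤ σ ω) : Measurable fun ω => X (σ ω) ω := by
  have := (measurable_of_rightCont (fun t ht => hX.measurable ht) hX.rightCont).comp
    (hσ.prodMk measurable_id)
  simpa [Function.comp_def, hσ0] using this

lemma IsLevy.measurable_infOn_time (hX : IsLevy P ℱ X) {σ : Ω → ℝ} (hσ : Measurable σ)
    (hσ0 : ∀ ω, 0 ≤ σ ω) {v : ℝ} (hv : 0 ≤ v) :
    Measurable fun ω => infOn (fun r => X r ω) (σ ω) (σ ω + v) := by
  have := (measurable_of_rightCont (g := fun t ω => infOn (fun r => X r ω) t (t + v))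
    (fun t ht => hX.measurable_infOn ht hv) (fun ω t ht => ?_)).comp (hσ.prodMk measurable_id)
  · simpa [Function.comp_def, hσ0] using this
  · refine (hX.isCadlag ω).infOn_tendsto ht (by linarith) tendsto_id ?_
      (Eventually.of_forall fun _ => le_add_of_nonneg_right hv)
    exact tendsto_nhdsWithin_iff.2 ⟨((continuous_add_const v).tendsto t).mono_left
      nhdsWithin_le_nhds, eventually_mem_nhdsWithin.mono fun s hs =>
        add_le_add_left (show t ≤ s from hs) v⟩

lemma IsLevy.measurable_infOn_time_prod (hX : IsLevy P ℱ X) {σ : Ω → ℝ} (hσ : Measurable σ)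
    (hσ0 : ∀ ω, 0 ≤ σ ω) :
    Measurable fun p : ℝ × Ω => infOn (fun r => X r p.2) (σ p.2) (σ p.2 + max p.1 0) := by
  refine measurable_of_rightCont (g := fun v ω => infOn (fun r => X r ω) (σ ω) (σ ω + v))
    (fun t ht => hX.measurable_infOn_time hσ hσ0 ht) fun ω t ht => ?_
  refine (hX.isCadlag ω).infOn_tendsto (hσ0 ω) (by linarith)
    (tendsto_nhdsWithin_iff.2 ⟨tendsto_const_nhds, Eventually.of_forall fun _ => self_mem_Ici⟩)
    (tendsto_nhdsWithin_iff.2 ⟨((continuous_const_add (σ ω)).tendsto t).mono_left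
      nhdsWithin_le_nhds, eventually_mem_nhdsWithin.mono fun s hs =>
        add_le_add_right (show t ≤ s from hs) _⟩)
    (eventually_mem_nhdsWithin.mono fun s hs =>
      le_add_of_nonneg_right (ht.trans (show t ≤ s from hs)))

lemma IsLevy.exp_infOn_le_one (hX : IsLevy P ℱ X) {β : ℝ} (hβ : 0 ≤ β) {s v : ℝ} (hs : 0 ≤ s)
    (hv : 0 ≤ v) (ω : Ω) :
    Real.exp (β * (infOn (fun r => X r ω) s (s + v) - X s ω)) ≤ 1 := by
  refine Real.exp_le_one_iff.2 (mul_nonpos_of_nonneg_of_nonpos hβ ?_)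
  linarith [(hX.isCadlag ω).infOn_le hs le_rfl (le_add_of_nonneg_right hv)]

lemma IsLevy.measurable_passagePayoff (hX : IsLevy P ℱ X) (α β y : ℝ) {σ : Ω → ℝ}
    (hσ : Measurable σ) (hσ0 : ∀ ω, 0 ≤ σ ω) : Measurable (passagePayoff X α β y σ) := by
  have h := hX.measurable_apply_time hσ hσ0
  exact Measurable.ite (hX.measurableSet_hitsBelow y)
    ((hσ.const_mul α).neg.add ((h.min measurable_const).const_mul β)).exp measurable_const

lemma IsLevy.integral_passagePayoff_grid (hX : IsLevy P ℱ X) {α β v : ℝ} (hα : 0 < α)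
    (hβ : 0 ≤ β) (hv : 0 ≤ v) (y : ℝ) (n : ℕ) {σ : Ω → ℝ}
    (hσ : σ = fun ω => gridTime n (tauBelow X y ω)) :
    ∫ ω, passagePayoff X α β y σ ω *
        Real.exp (β * (infOn (fun r => X r ω) (σ ω) (σ ω + v) - X (σ ω) ω)) ∂P =
      (∫ ω, passagePayoff X α β y σ ω ∂P) * ∫ ω, Real.exp (β * runInf X v ω) ∂P := by
  have := hX.isProb
  have hn0 : (0 : ℝ) < n + 1 := by positivity
  have hτ := hX.measurable_tauBelow y
  have hσ0 : ∀ ω, 0 ≤ σ ω := fun ω => by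
    rw [hσ]; exact (tauBelow_nonneg X y ω).trans (lt_gridTime n _).le
  have hσm : Measurable σ := by
    rw [hσ]; unfold gridTime; fun_prop
  have hZ := hX.measurable_passagePayoff α β y hσm hσ0
  have hZb := abs_passagePayoff_le_one (X := X) hα hβ y hσ0
  have hE : Measurable fun ω =>
      Real.exp (β * (infOn (fun r => X r ω) (σ ω) (σ ω + v) - X (σ ω) ω)) :=
    (((hX.measurable_infOn_time hσm hσ0 hv).sub
      (hX.measurable_apply_time hσm hσ0)).const_mul β).exp
  set S : ℕ → Set Ω := fun k => {ω | ⌊((n : ℝ) + 1) * tauBelow X y ω⌋₊ = k} with hS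
  have hSm : ∀ k, MeasurableSet (S k) := fun k =>
    (show Measurable fun ω => ⌊((n : ℝ) + 1) * tauBelow X y ω⌋₊ by fun_prop)
      (measurableSet_singleton k)
  have hSd : Pairwise (Function.onFun Disjoint S) := fun i j hij =>
    Set.disjoint_left.2 fun ω hi hj => hij (hi.symm.trans hj)
  have hSU : ⋃ k, S k = Set.univ := eq_univ_of_forall fun ω => mem_iUnion.2 ⟨_, rfl⟩
  have hint1 : Integrable (passagePayoff X α β y σ) P :=
    (integrable_const (1 : ℝ)).mono' hZ.aestronglyMeasurable (ae_of_all _ hZb)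
  have hint2 : Integrable (fun ω => passagePayoff X α β y σ ω *
      Real.exp (β * (infOn (fun r => X r ω) (σ ω) (σ ω + v) - X (σ ω) ω))) P := by
    refine (integrable_const (1 : ℝ)).mono' (hZ.mul hE).aestronglyMeasurable
      (ae_of_all _ fun ω => ?_)
    rw [norm_mul, Real.norm_eq_abs, Real.norm_eq_abs, Real.abs_exp]
    exact mul_le_one₀ (hZb ω) (Real.exp_pos _).le (hX.exp_infOn_le_one hβ (hσ0 ω) hv ω)
  have H1 := hasSum_integral_iUnion hSm hSd hint1.integrableOn
  have H2 := hasSum_integral_iUnion hSm hSd hint2.integrableOn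
  rw [hSU, setIntegral_univ] at H1 H2
  refine H2.tsum_eq.symm.trans ((tsum_congr fun k => ?_).trans (H1.mul_right _).tsum_eq)
  set t : ℝ := ((k : ℝ) + 1) / (n + 1) with ht
  have ht0 : 0 ≤ t := by positivity
  have hσS : ∀ ω ∈ S k, σ ω = t := fun ω hω => by
    have : ⌊((n : ℝ) + 1) * tauBelow X y ω⌋₊ = k := hω
    simp only [hσ, gridTime, this, ht]
  set A : Set Ω := S k ∩ {ω | hitsBelow X y ω} with hA
  have hAm : MeasurableSet[ℱ t] A := by
    have e : A = {ω | hitsBelow X y ω ∧ tauBelow X y ω < t} \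
        {ω | hitsBelow X y ω ∧ tauBelow X y ω < k / (n + 1)} := by
      ext ω
      have h0 : 0 ≤ ((n : ℝ) + 1) * tauBelow X y ω :=
        mul_nonneg hn0.le (tauBelow_nonneg X y ω)
      simp only [hA, hS, mem_inter_iff, mem_ofPred_eq, Set.mem_sdiff, Nat.floor_eq_iff h0, ht,
        lt_div_iff₀ hn0, mul_comm (tauBelow X y ω), not_and, not_lt]
      tauto
    rw [e]
    refine (hX.measurableSet_tauBelow_lt y t).diff (ℱ.mono ?_ _ (hX.measurableSet_tauBelow_lt y _))
    rw [ht]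
    gcongr
    linarith
  set Y : Ω → ℝ := A.indicator fun ω => Real.exp (-(α * t) + β * min (X t ω) 0) with hY
  have hYm : Measurable[ℱ t] Y := by
    have h := (hX.adapted t ht0).measurable
    exact Measurable.indicator ((((h.min measurable_const).const_mul β).const_add _).exp) hAm
  have hSY : ∀ ω, (S k).indicator (passagePayoff X α β y σ) ω = Y ω := fun ω => by
    by_cases h1 : ω ∈ S k <;> by_cases h2 : hitsBelow X y ω <;>
      simp [hY, hA, h1, h2, passagePayoff, hσS]
  have hYb : ∀ ω, |Y ω| ≤ 1 := fun ω => by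
    rw [← hSY]
    by_cases h1 : ω ∈ S k
    · simpa [h1] using hZb ω
    · simp [h1]
  have e1 : ∀ ω, (S k).indicator (fun ω => passagePayoff X α β y σ ω *
      Real.exp (β * (infOn (fun r => X r ω) (σ ω) (σ ω + v) - X (σ ω) ω))) ω =
      Y ω * Real.exp (β * (infOn (fun r => X r ω) t (t + v) - X t ω)) := fun ω => by
    rw [← hSY]
    by_cases h1 : ω ∈ S k
    · simp [h1, hσS ω h1]
    · simp [h1]
  rw [← integral_indicator (hSm k), ← integral_indicator (hSm k), funext e1, funext hSY]
  exact hX.integral_mul_infOn hβ ht0 hv hYm hYb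

lemma IsLevy.integral_passagePayoff (hX : IsLevy P ℱ X) {α β v : ℝ} (hα : 0 < α)
    (hβ : 0 ≤ β) (hv : 0 ≤ v) (y : ℝ) :
    ∫ ω, passagePayoff X α β y (tauBelow X y) ω * Real.exp (β *
        (infOn (fun r => X r ω) (tauBelow X y ω) (tauBelow X y ω + v) -
          X (tauBelow X y ω) ω)) ∂P =
      (∫ ω, passagePayoff X α β y (tauBelow X y) ω ∂P) *
        ∫ ω, Real.exp (β * runInf X v ω) ∂P := by
  have := hX.isProb
  set σ : ℕ → Ω → ℝ := fun n ω => gridTime n (tauBelow X y ω) with hσ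
  have hτ := hX.measurable_tauBelow y
  have hσ0 : ∀ n ω, 0 ≤ σ n ω := fun n ω =>
    (tauBelow_nonneg X y ω).trans (lt_gridTime n _).le
  have hσm : ∀ n, Measurable (σ n) := fun n => by
    simp only [hσ, gridTime]; fun_prop
  have hZ := fun n => hX.measurable_passagePayoff α β y (hσm n) (hσ0 n)
  have hZb := fun n => abs_passagePayoff_le_one (X := X) hα hβ y (hσ0 n)
  have hE : ∀ n, Measurable fun ω =>
      Real.exp (β * (infOn (fun r => X r ω) (σ n ω) (σ n ω + v) - X (σ n ω) ω)) := fun n =>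
    (((hX.measurable_infOn_time (hσm n) (hσ0 n) hv).sub
      (hX.measurable_apply_time (hσm n) (hσ0 n))).const_mul β).exp
  have hlim : ∀ ω, Tendsto (fun n => σ n ω) atTop
      (nhdsWithin (tauBelow X y ω) (Set.Ici (tauBelow X y ω))) := fun ω =>
    tendsto_gridTime (tauBelow_nonneg X y ω)
  have hXlim : ∀ ω, Tendsto (fun n => X (σ n ω) ω) atTop (nhds (X (tauBelow X y ω) ω)) :=
    fun ω => (hX.rightCont ω _ (tauBelow_nonneg X y ω)).tendsto.comp (hlim ω)
  have hZlim : ∀ ω, Tendsto (fun n => passagePayoff X α β y (σ n) ω) atTop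
      (nhds (passagePayoff X α β y (tauBelow X y) ω)) := fun ω => by
    unfold passagePayoff
    split_ifs
    · exact ((((hlim ω).mono_right nhdsWithin_le_nhds).const_mul α).neg.add
        (((hXlim ω).min tendsto_const_nhds).const_mul β)).rexp
    · exact tendsto_const_nhds
  have hElim : ∀ ω, Tendsto (fun n =>
      Real.exp (β * (infOn (fun r => X r ω) (σ n ω) (σ n ω + v) - X (σ n ω) ω))) atTop
      (nhds (Real.exp (β * (infOn (fun r => X r ω) (tauBelow X y ω) (tauBelow X y ω + v) -
          X (tauBelow X y ω) ω)))) := fun ω => by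
    refine ((((hX.isCadlag ω).infOn_tendsto (tauBelow_nonneg X y ω) (by linarith) (hlim ω) ?_
      (Eventually.of_forall fun _ => le_add_of_nonneg_right hv)).sub (hXlim ω)).const_mul β).rexp
    exact tendsto_nhdsWithin_iff.2 ⟨((hlim ω).mono_right nhdsWithin_le_nhds).add_const v,
      Eventually.of_forall fun n => add_le_add_left (lt_gridTime n _).le v⟩
  have L1 : Tendsto (fun n => ∫ ω, passagePayoff X α β y (σ n) ω ∂P) atTop
      (nhds (∫ ω, passagePayoff X α β y (tauBelow X y) ω ∂P)) :=
    tendsto_integral_of_dominated_convergence (fun _ => 1)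
      (fun n => (hZ n).aestronglyMeasurable) (integrable_const _)
      (fun n => ae_of_all _ (hZb n)) (ae_of_all _ hZlim)
  have L2 := tendsto_integral_of_dominated_convergence (μ := P) (fun _ => (1 : ℝ))
    (fun n => ((hZ n).mul (hE n)).aestronglyMeasurable) (integrable_const _)
    (fun n => ae_of_all _ fun ω => by
      simp only [Pi.mul_apply, norm_mul, Real.norm_eq_abs, Real.abs_exp]
      exact mul_le_one₀ (hZb n ω) (Real.exp_pos _).le
        (hX.exp_infOn_le_one hβ (hσ0 n ω) hv ω))
    (ae_of_all _ fun ω => (hZlim ω).mul (hElim ω))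
  refine tendsto_nhds_unique (L2.congr fun n => ?_) (L1.mul_const _)
  exact hX.integral_passagePayoff_grid hα hβ hv y n rfl

lemma integral_exp_mul_integral_swap [IsProbabilityMeasure P] {α : ℝ} (hα : 0 < α)
    {G : ℝ → Ω → ℝ} (hG : Measurable fun p : ℝ × Ω => G (max p.1 0) p.2)
    (hb : ∀ t, 0 ≤ t → ∀ ω, |G t ω| ≤ 1) :
    ∫ t in Set.Ioi (0 : ℝ), α * Real.exp (-(α * t)) * ∫ ω, G t ω ∂P =
      ∫ ω, (∫ t in Set.Ioi (0 : ℝ), α * Real.exp (-(α * t)) * G t ω) ∂P := by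
  have hmax : ∀ t ∈ Set.Ioi (0 : ℝ), max t 0 = t := fun t ht => max_eq_left (le_of_lt ht)
  have hint : Integrable (Function.uncurry fun (t : ℝ) (ω : Ω) =>
      α * Real.exp (-(α * t)) * G (max t 0) ω) ((volume.restrict (Set.Ioi 0)).prod P) := by
    have h1 : Integrable (fun t : ℝ => α * Real.exp (-(α * t)))
        (volume.restrict (Set.Ioi 0)) := by
      have := (exp_neg_integrableOn_Ioi 0 hα).const_mul α
      simpa only [neg_mul] using this
    refine (h1.comp_fst P).mono' (Measurable.aestronglyMeasurable ?_) (ae_of_all _ fun p => ?_)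
    · exact Measurable.mul (by fun_prop) hG
    · simp only [Function.uncurry, norm_mul, Real.norm_eq_abs, Real.abs_exp, abs_of_pos hα]
      exact mul_le_of_le_one_right (by positivity) (hb _ (le_max_right _ _) _)
  calc _ = ∫ t in Set.Ioi (0 : ℝ), ∫ ω, α * Real.exp (-(α * t)) * G (max t 0) ω ∂P := by
        refine setIntegral_congr_fun measurableSet_Ioi fun t ht => ?_
        simp only [hmax t ht, integral_const_mul]
    _ = ∫ ω, (∫ t in Set.Ioi (0 : ℝ), α * Real.exp (-(α * t)) * G (max t 0) ω) ∂P :=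
        integral_integral_swap hint
    _ = _ := by
        refine integral_congr_ae (ae_of_all _ fun ω => ?_)
        refine setIntegral_congr_fun measurableSet_Ioi fun t ht => ?_
        simp only [hmax t ht]

lemma IsLevy.setIntegral_runInf_lt (hX : IsLevy P ℱ X) (α β : ℝ) {y : ℝ} (hy : y ≤ 0) (ω : Ω) :
    ∫ t in Set.Ioi (0 : ℝ), α * Real.exp (-(α * t)) *
        (if runInf X t ω < y then Real.exp (β * runInf X t ω) else 0) =
      ∫ v in Set.Ioi (0 : ℝ), α * Real.exp (-(α * v)) *
        (passagePayoff X α β y (tauBelow X y) ω * Real.exp (β *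
          (infOn (fun r => X r ω) (tauBelow X y ω) (tauBelow X y ω + v) -
            X (tauBelow X y ω) ω))) := by
  set f : ℝ → ℝ := fun r => X r ω with hf
  have hc : IsCadlag f := hX.isCadlag ω
  have hrun : ∀ t, runInf X t ω = infOn f 0 t := fun t => rfl
  simp only [hrun]
  by_cases hit : hitsBelow X y ω
  swap
  · have hno : ∀ t ∈ Set.Ioi (0 : ℝ), ¬ infOn f 0 t < y := fun t ht h => by
      obtain ⟨s, h1, -, h2⟩ := exists_lt_of_infOn_lt (le_of_lt ht) h
      exact hit ⟨s, h1, h2⟩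
    refine setIntegral_congr_fun measurableSet_Ioi fun t ht => ?_
    simp [hno t ht, passagePayoff, hit]
  set τ := tauBelow X y ω with hτ
  have hτ0 : 0 ≤ τ := tauBelow_nonneg X y ω
  have hfτ : f τ ≤ y := hX.apply_tauBelow_le hit
  set k : ℝ → ℝ := fun t => α * Real.exp (-(α * t)) * Real.exp (β * infOn f τ t) with hk
  calc _ = ∫ t in Set.Ioi (0 : ℝ), (Set.Ioi τ).indicator k t := by
        refine setIntegral_congr_ae measurableSet_Ioi ?_
        filter_upwards [compl_mem_ae_iff.2 (measure_singleton τ)] with t ht ht0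
        rcases lt_or_gt_of_ne (show t ≠ τ from ht) with h | h
        · have : ¬ infOn f 0 t < y := not_lt.2 <| le_infOn (le_of_lt ht0) fun r h1 h2 =>
            le_of_lt_tauBelow h1 (h2.trans_lt h)
          simp [this, h.le]
        · obtain ⟨s, h1, h2, h3⟩ := exists_lt_of_tauBelow_lt hit h
          have hlt : infOn f τ t < y := (hc.infOn_le hτ0 h1 h2.le).trans_lt h3
          have e : infOn f 0 t = infOn f τ t := by
            refine le_antisymm (le_infOn h.le fun r hr1 hr2 =>
              hc.infOn_le le_rfl (hτ0.trans hr1) hr2) (le_infOn (le_of_lt ht0) fun r hr1 hr2 => ?_)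
            rcases lt_or_ge r τ with hr | hr
            · exact hlt.le.trans (le_of_lt_tauBelow hr1 hr)
            · exact hc.infOn_le hτ0 hr hr2
          simp [e, hlt, h, hk]
    _ = ∫ t in Set.Ioi τ, k t := by
        rw [setIntegral_indicator measurableSet_Ioi,
          inter_eq_right.2 (Set.Ioi_subset_Ioi hτ0)]
    _ = ∫ v in Set.Ioi (0 : ℝ), k (τ + v) := by
        rw [← (measurePreserving_add_left volume τ).setIntegral_preimage_emb
          (measurableEmbedding_addLeft τ) k (Set.Ioi τ)]
        simp
    _ = _ := by
        refine setIntegral_congr_fun measurableSet_Ioi fun v _ => ?_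
        have : X τ ω ≤ 0 := hfτ.trans hy
        simp only [hk, passagePayoff, if_pos hit, ← hτ, min_eq_left this]
        rw [mul_assoc, mul_assoc, ← Real.exp_add, ← Real.exp_add, ← Real.exp_add]
        congr 2
        ring

end Levy

theorem stmt2 [m0 : MeasurableSpace Ω] (P : Measure Ω) (ℱ : Filtration ℝ m0)
    (X : ℝ → Ω → ℝ) (hX : IsLevy P ℱ X)
    (α β x : ℝ) (hα : 0 < α) (hβ : 0 ≤ β) (hx : 0 ≤ x) :
    (∫ ω, (if hitsBelow X (-x) ω then
        Real.exp (-(α * tauBelow X (-x) ω) + β * X (tauBelow X (-x) ω) ω) else 0) ∂P) *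
      (∫ t in Set.Ioi (0 : ℝ), α * Real.exp (-(α * t)) *
        (∫ ω, Real.exp (β * runInf X t ω) ∂P)) =
      ∫ t in Set.Ioi (0 : ℝ), α * Real.exp (-(α * t)) *
        (∫ ω, (if runInf X t ω < -x then Real.exp (β * runInf X t ω) else 0) ∂P) := by
  have := hX.isProb
  have hy : -x ≤ 0 := by linarith
  have hτ := hX.measurable_tauBelow (-x)
  have hτ0 := tauBelow_nonneg X (-x)
  have hZ : ∀ ω, (if hitsBelow X (-x) ω then
      Real.exp (-(α * tauBelow X (-x) ω) + β * X (tauBelow X (-x) ω) ω) else 0) =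
      passagePayoff X α β (-x) (tauBelow X (-x)) ω := fun ω => by
    by_cases hit : hitsBelow X (-x) ω
    · simp [passagePayoff, hit, (hX.apply_tauBelow_le hit).trans hy]
    · simp [passagePayoff, hit]
  have hR : Measurable fun p : ℝ × Ω => runInf X (max p.1 0) p.2 := by
    have := hX.measurable_infOn_time_prod (σ := fun _ => 0) measurable_const fun _ => le_rfl
    simpa only [zero_add, runInf, infOn] using this
  rw [integral_exp_mul_integral_swap hα
      (G := fun t ω => if runInf X t ω < -x then Real.exp (β * runInf X t ω) else 0)
      (Measurable.ite (measurableSet_lt hR measurable_const) (hR.const_mul β).exp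
        measurable_const) fun t _ ω => ?_]
  · simp_rw [hX.setIntegral_runInf_lt α β hy]
    rw [← integral_exp_mul_integral_swap hα (G := fun v ω =>
      passagePayoff X α β (-x) (tauBelow X (-x)) ω * Real.exp (β *
        (infOn (fun r => X r ω) (tauBelow X (-x) ω) (tauBelow X (-x) ω + v) -
          X (tauBelow X (-x) ω) ω))) ?_ fun t ht ω => ?_, ← integral_const_mul]
    · refine setIntegral_congr_fun measurableSet_Ioi fun v hv => ?_
      simp only [hZ]
      rw [hX.integral_passagePayoff hα hβ (le_of_lt hv)]
      ring
    · exact ((hX.measurable_passagePayoff α β (-x) hτ hτ0).comp measurable_snd).mul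
        (((hX.measurable_infOn_time_prod hτ hτ0).sub
          ((hX.measurable_apply_time hτ hτ0).comp measurable_snd)).const_mul β).exp
    · rw [abs_mul, Real.abs_exp]
      exact mul_le_one₀ (abs_passagePayoff_le_one hα hβ _ hτ0 ω) (Real.exp_pos _).le
        (hX.exp_infOn_le_one hβ (hτ0 ω) ht ω)
  · split_ifs with h
    · rw [Real.abs_exp, Real.exp_le_one_iff]
      exact mul_nonpos_of_nonneg_of_nonpos hβ (h.le.trans hy)
    · simp

end AKLevy
end
end
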